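/- arXiv:math/0003028 — 4 statements merged into one kernel-verified Lean document; each statement's English description precedes it below -/
import Mathlib

section
/- Let n ≥ 2 and let σ be an n-cycle in the symmetric group on n letters, i.e. σ : Equiv.Perm (Fin n) is a cycle whose support is all of Fin n. Then the number of ordered (n−1)-tuples (τ_1, …, τ_{n−1}) of transpositions in Equiv.Perm (Fin n) with τ_1 * τ_2 * ⋯ * τ_{n−1} = σ equals n^(n−2). (Dénes' theorem, used in the proof of Lemma 3.8: 'the number of ways of factoring an α_i-cycle into α_i−1 transpositions is α_i^{α_i−2}'.) -/
open Finset

namespace Equiv.Perm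

/-- `f` moves points only inside the classes of any equivalence relation containing its graph. -/
theorem SameCycle.of_forall_apply {α : Type*} [Finite α] {f : Perm α} {x y : α} {r : α → α → Prop} (hr : Equivalence r)
    (h : ∀ x, r x (f x)) (hxy : f.SameCycle x y) : r x y := by
  obtain ⟨i, rfl⟩ := hxy.exists_nat_pow_eq
  clear hxy
  induction i with
  | zero => exact hr.refl x
  | succ i ih => rw [pow_succ']; exact hr.trans ih (h _)

section Orbits

variable {α : Type*} [Fintype α] [DecidableEq α]

/-- The cycle of `f` through `a`, as a finset; it is `{a}` when `a` is a fixed point. -/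
def orbitFinset (f : Perm α) (a : α) : Finset α := {x | f.SameCycle a x}

/-- The partition of the ground set into the cycles of `f`, fixed points included. -/
def orbits (f : Perm α) : Finset (Finset α) := univ.image f.orbitFinset

variable {f g : Perm α} {a b x y : α}

theorem mem_orbitFinset : x ∈ f.orbitFinset a ↔ f.SameCycle a x := by
  simp [orbitFinset]

theorem orbitFinset_eq_iff : f.orbitFinset a = f.orbitFinset b ↔ f.SameCycle a b := by
  refine ⟨fun h => ?_, fun h => ?_⟩
  · rw [← mem_orbitFinset, h, mem_orbitFinset]
  · ext x
    simp only [mem_orbitFinset]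
    exact ⟨h.symm.trans, h.trans⟩

theorem orbitFinset_mem_orbits (f : Perm α) (a : α) : f.orbitFinset a ∈ f.orbits :=
  mem_image_of_mem _ (mem_univ a)

theorem card_orbitFinset_pos (f : Perm α) (a : α) : 0 < #(f.orbitFinset a) :=
  card_pos.2 ⟨a, mem_orbitFinset.2 (SameCycle.refl f a)⟩

theorem card_orbits_pos [Nonempty α] (f : Perm α) : 0 < #f.orbits :=
  card_pos.2 (univ_nonempty.image _)

/-- Finer cycle partitions have more parts. -/
theorem card_orbits_le_of_sameCycle (h : ∀ x y, g.SameCycle x y → f.SameCycle x y) :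
    #f.orbits ≤ #g.orbits := by
  have key : ∀ s ∈ f.orbits, ∃ t ∈ g.orbits, ∃ a, s = f.orbitFinset a ∧ t = g.orbitFinset a := by
    intro s hs
    obtain ⟨a, -, rfl⟩ := mem_image.1 hs
    exact ⟨_, g.orbitFinset_mem_orbits a, a, rfl, rfl⟩
  choose! i hi ha using key
  refine card_le_card_of_injOn i hi ?_
  intro s hs t ht hst
  obtain ⟨a, rfl, ha'⟩ := ha s hs
  obtain ⟨b, rfl, hb'⟩ := ha t ht
  exact orbitFinset_eq_iff.2 (h _ _ (orbitFinset_eq_iff.1 (ha' ▸ hb' ▸ hst)))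

theorem sum_orbits_comp {M : Type*} [AddCommMonoid M] (f : Perm α) (F : α → M) :
    ∑ s ∈ f.orbits, ∑ a ∈ s, F a = ∑ a, F a := by
  rw [← sum_fiberwise_of_maps_to (s := univ) (t := f.orbits) (g := f.orbitFinset)
    (fun a _ => f.orbitFinset_mem_orbits a)]
  refine sum_congr rfl fun s hs => sum_congr ?_ fun _ _ => rfl
  obtain ⟨b, -, rfl⟩ := mem_image.1 hs
  ext x
  simp [mem_orbitFinset, orbitFinset_eq_iff, sameCycle_comm]

theorem sum_inv_card_orbitFinset (f : Perm α) :
    ∑ a, (#(f.orbitFinset a) : ℚ)⁻¹ = #f.orbits := by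
  rw [← sum_orbits_comp f, card_eq_sum_ones, Nat.cast_sum]
  refine sum_congr rfl fun s hs => ?_
  obtain ⟨b, -, rfl⟩ := mem_image.1 hs
  have : ∀ a ∈ f.orbitFinset b, (#(f.orbitFinset a) : ℚ)⁻¹ = (#(f.orbitFinset b) : ℚ)⁻¹ := by
    intro a ha
    rw [orbitFinset_eq_iff.2 (mem_orbitFinset.1 ha)]
  rw [sum_congr rfl this, sum_const, nsmul_eq_mul, Nat.cast_one]
  exact mul_inv_cancel₀ (by exact_mod_cast (f.card_orbitFinset_pos b).ne')

theorem SameCycle.of_mul_swap (hab : f.SameCycle a b) (h : (f * swap a b).SameCycle x y) :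
    f.SameCycle x y := by
  refine h.of_forall_apply (SameCycle.equivalence f) fun z => ?_
  rw [mul_apply, sameCycle_apply_right]
  rcases eq_or_ne z a with rfl | hza
  · rwa [swap_apply_left]
  rcases eq_or_ne z b with rfl | hzb
  · rw [swap_apply_right]; exact hab.symm
  · rw [swap_apply_of_ne_of_ne hza hzb]

theorem sameCycle_mul_swap_self (hab : ¬ f.SameCycle a b) : (f * swap a b).SameCycle a b := by
  have hper : ∃ j, 0 < j ∧ (f ^ j) b = b :=
    ⟨orderOf f, orderOf_pos f, by rw [pow_orderOf_eq_one, one_apply]⟩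
  classical
  obtain ⟨hpos, hfix⟩ := Nat.find_spec hper
  have hmin := fun i => Nat.find_min hper (m := i)
  set j := Nat.find hper
  have key : ∀ i, i + 1 ≤ j → ((f * swap a b) ^ (i + 1)) a = (f ^ (i + 1)) b := by
    intro i
    induction i with
    | zero => intro _; simp
    | succ i ih =>
      intro hi
      have hne_b : (f ^ (i + 1)) b ≠ b := fun h => hmin (i + 1) (by lia) ⟨by lia, h⟩
      have hne_a : (f ^ (i + 1)) b ≠ a := fun h =>
        hab (SameCycle.symm ⟨(i + 1 : ℕ), by rwa [zpow_natCast]⟩)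
      rw [pow_succ', mul_apply, ih (by lia), mul_apply, swap_apply_of_ne_of_ne hne_a hne_b,
        pow_succ' f (i + 1), mul_apply]
  refine ⟨j, ?_⟩
  obtain ⟨i, hi⟩ : ∃ i, j = i + 1 := ⟨j - 1, by lia⟩
  rw [zpow_natCast, hi, key i hi.ge, ← hi, hfix]

/-- Multiplying by a transposition of points in different cycles merges these two cycles. -/
theorem sameCycle_mul_swap_iff (hab : ¬ f.SameCycle a b) :
    (f * swap a b).SameCycle x y ↔ f.SameCycle x y ∨
      (f.SameCycle a x ∨ f.SameCycle b x) ∧ (f.SameCycle a y ∨ f.SameCycle b y) := by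
  have hself := sameCycle_mul_swap_self hab
  have hmono : ∀ {u v}, f.SameCycle u v → (f * swap a b).SameCycle u v := fun {u v} h =>
    hself.of_mul_swap (by rwa [mul_assoc, swap_mul_self, mul_one])
  constructor
  · refine fun h => h.of_forall_apply (r := fun x y => f.SameCycle x y ∨
      (f.SameCycle a x ∨ f.SameCycle b x) ∧ (f.SameCycle a y ∨ f.SameCycle b y)) ?_ fun z => ?_
    · refine ⟨fun x => .inl (.refl f x), fun {x y} h => h.imp .symm And.symm, ?_⟩
      rintro x y z (hxy | ⟨hx, hy⟩) (hyz | ⟨hy', hz⟩)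
      · exact .inl (hxy.trans hyz)
      · exact .inr ⟨hy'.imp (·.trans hxy.symm) (·.trans hxy.symm), hz⟩
      · exact .inr ⟨hx, hy.imp (·.trans hyz) (·.trans hyz)⟩
      · exact .inr ⟨hx, hz⟩
    · simp only [mul_apply, sameCycle_apply_right]
      rcases eq_or_ne z a with rfl | hza
      · rw [swap_apply_left]; exact .inr ⟨.inl .rfl, .inr .rfl⟩
      rcases eq_or_ne z b with rfl | hzb
      · rw [swap_apply_right]; exact .inr ⟨.inr .rfl, .inl .rfl⟩
      · rw [swap_apply_of_ne_of_ne hza hzb]; exact .inl .rfl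
  · rintro (h | ⟨hx, hy⟩)
    · exact hmono h
    · have hx' : (f * swap a b).SameCycle a x := hx.elim hmono fun h => hself.trans (hmono h)
      have hy' : (f * swap a b).SameCycle a y := hy.elim hmono fun h => hself.trans (hmono h)
      exact hx'.symm.trans hy'

theorem orbitFinset_mul_swap_of_sameCycle (hab : ¬ f.SameCycle a b)
    (hx : f.SameCycle a x ∨ f.SameCycle b x) :
    (f * swap a b).orbitFinset x = f.orbitFinset a ∪ f.orbitFinset b := by
  ext y
  simp only [mem_union, mem_orbitFinset, sameCycle_mul_swap_iff hab, hx, true_and]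
  exact or_iff_right_of_imp fun h => hx.imp (·.trans h) (·.trans h)

theorem orbitFinset_mul_swap_of_not_sameCycle (hab : ¬ f.SameCycle a b)
    (hx : ¬ (f.SameCycle a x ∨ f.SameCycle b x)) :
    (f * swap a b).orbitFinset x = f.orbitFinset x := by
  ext y
  simp only [mem_orbitFinset, sameCycle_mul_swap_iff hab, hx, false_and, or_false]

theorem orbits_mul_swap (hab : ¬ f.SameCycle a b) :
    (f * swap a b).orbits = insert (f.orbitFinset a ∪ f.orbitFinset b)
      ((f.orbits.erase (f.orbitFinset a)).erase (f.orbitFinset b)) := by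
  ext s
  simp only [mem_insert, mem_erase]
  constructor
  · intro hs
    obtain ⟨x, -, rfl⟩ := mem_image.1 hs
    by_cases hx : f.SameCycle a x ∨ f.SameCycle b x
    · exact .inl (orbitFinset_mul_swap_of_sameCycle hab hx)
    · rw [orbitFinset_mul_swap_of_not_sameCycle hab hx]
      rw [not_or] at hx
      exact .inr ⟨fun h => hx.2 (orbitFinset_eq_iff.1 h.symm),
        fun h => hx.1 (orbitFinset_eq_iff.1 h.symm), f.orbitFinset_mem_orbits x⟩
  · rintro (rfl | ⟨hb, ha, hs⟩)
    · rw [← orbitFinset_mul_swap_of_sameCycle hab (.inl .rfl)]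
      exact orbitFinset_mem_orbits _ _
    · obtain ⟨x, -, rfl⟩ := mem_image.1 hs
      rw [Ne, orbitFinset_eq_iff, sameCycle_comm] at ha hb
      rw [← orbitFinset_mul_swap_of_not_sameCycle hab (not_or.2 ⟨ha, hb⟩)]
      exact orbitFinset_mem_orbits _ _

theorem union_orbitFinset_notMem_orbits (hab : ¬ f.SameCycle a b) :
    f.orbitFinset a ∪ f.orbitFinset b ∉ f.orbits := by
  intro h
  obtain ⟨x, -, hx⟩ := mem_image.1 h
  have ha : f.SameCycle x a := by
    rw [← mem_orbitFinset, hx]; exact mem_union_left _ (mem_orbitFinset.2 .rfl)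
  have hb : f.SameCycle x b := by
    rw [← mem_orbitFinset, hx]; exact mem_union_right _ (mem_orbitFinset.2 .rfl)
  exact hab (ha.symm.trans hb)

theorem orbitFinset_mem_orbits_erase (hab : ¬ f.SameCycle a b) :
    f.orbitFinset b ∈ f.orbits.erase (f.orbitFinset a) :=
  mem_erase.2 ⟨fun h => hab (orbitFinset_eq_iff.1 h.symm), f.orbitFinset_mem_orbits b⟩

theorem card_orbits_mul_swap (hab : ¬ f.SameCycle a b) :
    #(f * swap a b).orbits + 1 = #f.orbits := by
  rw [orbits_mul_swap hab, card_insert_of_notMem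
    fun h => union_orbitFinset_notMem_orbits hab (mem_of_mem_erase (mem_of_mem_erase h)),
    card_erase_add_one (orbitFinset_mem_orbits_erase hab),
    card_erase_add_one (f.orbitFinset_mem_orbits a)]

theorem card_orbitFinset_union (hab : ¬ f.SameCycle a b) :
    #(f.orbitFinset a ∪ f.orbitFinset b) = #(f.orbitFinset a) + #(f.orbitFinset b) := by
  refine card_union_of_disjoint (disjoint_left.2 fun x ha hb => hab ?_)
  exact (mem_orbitFinset.1 ha).trans (mem_orbitFinset.1 hb).symm

theorem prod_card_orbits_mul_swap (hab : ¬ f.SameCycle a b) :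
    ∏ s ∈ (f * swap a b).orbits, (#s : ℚ) =
      (∏ s ∈ f.orbits, (#s : ℚ)) *
        ((#(f.orbitFinset a) : ℚ)⁻¹ + (#(f.orbitFinset b) : ℚ)⁻¹) := by
  rw [orbits_mul_swap hab, prod_insert
    fun h => union_orbitFinset_notMem_orbits hab (mem_of_mem_erase (mem_of_mem_erase h)),
    ← mul_prod_erase f.orbits _ (f.orbitFinset_mem_orbits a),
    ← mul_prod_erase _ _ (orbitFinset_mem_orbits_erase hab), card_orbitFinset_union hab]
  have ha : (#(f.orbitFinset a) : ℚ) ≠ 0 := by exact_mod_cast (f.card_orbitFinset_pos a).ne'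
  have hb : (#(f.orbitFinset b) : ℚ) ≠ 0 := by exact_mod_cast (f.card_orbitFinset_pos b).ne'
  push_cast
  field_simp
  ring

theorem card_orbits_le_card_orbits_mul_swap (f : Perm α) (a b : α) :
    #f.orbits ≤ #(f * swap a b).orbits + 1 := by
  by_cases hab : f.SameCycle a b
  · exact (card_orbits_le_of_sameCycle fun _ _ => hab.of_mul_swap).trans (Nat.le_succ _)
  · exact (card_orbits_mul_swap hab).ge

theorem sum_inv_add_inv_card_orbitFinset (f : Perm α) :
    ∑ p : α × α with ¬ f.SameCycle p.1 p.2,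
      ((#(f.orbitFinset p.1) : ℚ)⁻¹ + (#(f.orbitFinset p.2) : ℚ)⁻¹) =
      2 * (Fintype.card α * (#f.orbits - 1)) := by
  have half : ∑ p : α × α with ¬ f.SameCycle p.1 p.2, (#(f.orbitFinset p.1) : ℚ)⁻¹ =
      Fintype.card α * (#f.orbits - 1) := by
    have hrow : ∀ a, ∑ b with ¬ f.SameCycle a b, (#(f.orbitFinset a) : ℚ)⁻¹ =
        Fintype.card α * (#(f.orbitFinset a) : ℚ)⁻¹ - 1 := by
      intro a
      have hc : #{b | ¬ f.SameCycle a b} + #(f.orbitFinset a) = Fintype.card α := by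
        rw [add_comm, orbitFinset, card_filter_add_card_filter_not, card_univ]
      have ha : (#(f.orbitFinset a) : ℚ) ≠ 0 := by exact_mod_cast (f.card_orbitFinset_pos a).ne'
      rw [sum_const, nsmul_eq_mul, ← hc]
      push_cast
      field_simp
      ring
    rw [sum_filter, Fintype.sum_prod_type]
    simp only [← sum_filter, hrow, sum_sub_distrib, ← mul_sum, sum_inv_card_orbitFinset]
    simp [mul_sub]
  rw [sum_add_distrib, two_mul]
  refine congrArg₂ _ half (half ▸ ?_)
  refine sum_equiv (Equiv.prodComm α α) (fun p => ?_) fun p _ => rfl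
  simp [sameCycle_comm]

theorem sum_card_orbits (f : Perm α) : ∑ s ∈ f.orbits, #s = Fintype.card α := by
  simpa only [card_eq_sum_ones, Fintype.card_eq_sum_ones] using sum_orbits_comp f fun _ => 1

theorem orbitFinset_one (a : α) : (1 : Perm α).orbitFinset a = {a} := by
  ext x
  simp [mem_orbitFinset, eq_comm]

theorem card_orbits_one : #(1 : Perm α).orbits = Fintype.card α := by
  refine card_image_of_injective _ fun a b h => ?_
  simpa [orbitFinset_one] using h

theorem prod_card_orbits_one : ∏ s ∈ (1 : Perm α).orbits, (#s : ℚ) = 1 := by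
  refine prod_eq_one fun s hs => ?_
  obtain ⟨a, -, rfl⟩ := mem_image.1 hs
  simp [orbitFinset_one]

theorem card_orbits_eq_one_iff_sameCycle [Nonempty α] :
    #f.orbits = 1 ↔ ∀ x y, f.SameCycle x y := by
  refine ⟨fun h x y => ?_, fun h => (card_le_one.2 ?_).antisymm f.card_orbits_pos⟩
  · exact orbitFinset_eq_iff.1 (card_le_one.1 h.le _ (f.orbitFinset_mem_orbits x) _
      (f.orbitFinset_mem_orbits y))
  · intro s hs t ht
    obtain ⟨a, -, rfl⟩ := mem_image.1 hs
    obtain ⟨b, -, rfl⟩ := mem_image.1 ht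
    exact orbitFinset_eq_iff.2 (h a b)

theorem card_orbits_eq_one_iff_cycleType [Nontrivial α] :
    #f.orbits = 1 ↔ f.cycleType = {Fintype.card α} := by
  rw [card_orbits_eq_one_iff_sameCycle]
  constructor
  · intro h
    have hne : ∀ x, f x ≠ x := fun x hx => by
      obtain ⟨y, hy⟩ := exists_ne x
      exact hy ((h x y).eq_of_left hx).symm
    have hf : f.IsCycle :=
      ⟨Classical.arbitrary α, hne _, fun y _ => h _ y⟩
    have hsupp : f.support = univ := by
      ext x
      simp [hne]
    rw [hf.cycleType, hsupp, card_univ]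
  · intro h x y
    have hf : f.IsCycle := card_cycleType_eq_one.1 (by rw [h, Multiset.card_singleton])
    have hsupp : f.support = univ := by
      rw [← card_eq_iff_eq_univ, ← sum_cycleType, h, Multiset.sum_singleton]
    have hne : ∀ z, f z ≠ z := fun z => mem_support.1 (hsupp ▸ mem_univ z)
    exact hf.sameCycle (hne x) (hne y)

end Orbits

theorem swap_eq_swap_iff {α : Type*} [DecidableEq α] {a b c d : α} (hab : a ≠ b) :
    swap c d = swap a b ↔ (c = a ∧ d = b) ∨ (c = b ∧ d = a) := by
  constructor
  · intro h
    have ha : swap c d a = b := by rw [h, swap_apply_left]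
    rw [swap_apply_def] at ha
    grind
  · rintro (⟨rfl, rfl⟩ | ⟨rfl, rfl⟩)
    · rfl
    · exact swap_comm _ _

section Factorizations

variable {α : Type*} [Fintype α] [DecidableEq α]

variable (α) in
/-- The transpositions of `α`. -/
def swaps : Finset (Perm α) := {τ | #τ.support = 2}

theorem mem_swaps {τ : Perm α} : τ ∈ swaps α ↔ τ.IsSwap := by
  simp [swaps, card_support_eq_two]

theorem sum_offDiag_swap (F : Perm α → ℚ) :
    ∑ p ∈ univ.offDiag, F (swap p.1 p.2) = 2 * ∑ τ ∈ swaps α, F τ := by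
  rw [← sum_fiberwise_of_maps_to (s := univ.offDiag) (t := swaps α) (g := fun p => swap p.1 p.2)
    (fun p hp => mem_swaps.2 ⟨p.1, p.2, (mem_offDiag.1 hp).2.2, rfl⟩), mul_sum]
  refine sum_congr rfl fun τ hτ => ?_
  obtain ⟨a, b, hab, rfl⟩ := mem_swaps.1 hτ
  have hfib : {p ∈ (univ : Finset α).offDiag | swap p.1 p.2 = swap a b} = {(a, b), (b, a)} := by
    ext ⟨c, d⟩
    simp only [mem_filter, mem_offDiag, mem_univ, true_and, swap_eq_swap_iff hab, mem_insert,
      mem_singleton, Prod.mk.injEq]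
    grind
  rw [hfib, sum_pair (by simp [hab]), swap_comm b a, two_mul]

/-- The number of `m`-tuples of transpositions whose ordered product, multiplied on the left by
`f`, has a single cycle. -/
def transitiveCompletions (m : ℕ) (f : Perm α) : ℕ :=
  #{τ ∈ Fintype.piFinset fun _ : Fin m => swaps α | #(f * (List.ofFn τ).prod).orbits = 1}

theorem transitiveCompletions_zero (f : Perm α) :
    transitiveCompletions 0 f = if #f.orbits = 1 then 1 else 0 := by
  simp [transitiveCompletions, Finset.filter_const, apply_ite card]

theorem transitiveCompletions_succ (m : ℕ) (f : Perm α) :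
    transitiveCompletions (m + 1) f = ∑ τ ∈ swaps α, transitiveCompletions m (f * τ) := by
  simp only [transitiveCompletions]
  rw [← card_sigma]
  refine card_bij' (fun t _ => ⟨t 0, fun i => t i.succ⟩) (fun p _ => Fin.cons p.1 p.2) ?_ ?_ ?_ ?_
  · intro t ht
    simp only [mem_filter, Fintype.mem_piFinset, List.ofFn_succ, List.prod_cons, mem_sigma,
      ← mul_assoc] at ht ⊢
    exact ⟨ht.1 0, fun i => ht.1 i.succ, ht.2⟩
  · rintro ⟨τ, t⟩ ht
    simp only [mem_filter, Fintype.mem_piFinset, List.ofFn_succ, List.prod_cons, mem_sigma,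
      ← mul_assoc, Fin.forall_fin_succ, Fin.cons_zero, Fin.cons_succ] at ht ⊢
    exact ⟨⟨ht.1, ht.2.1⟩, ht.2.2⟩
  · intro t _
    exact Fin.cons_self_tail t
  · rintro ⟨τ, t⟩ _
    simp

theorem transitiveCompletions_eq_zero {m : ℕ} {f : Perm α} (h : m + 2 ≤ #f.orbits) :
    transitiveCompletions m f = 0 := by
  induction m generalizing f with
  | zero => rw [transitiveCompletions_zero, if_neg (by lia)]
  | succ m ih =>
    rw [transitiveCompletions_succ]
    refine sum_eq_zero fun τ hτ => ih ?_
    obtain ⟨a, b, -, rfl⟩ := mem_swaps.1 hτ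
    have := f.card_orbits_le_card_orbits_mul_swap a b
    lia

/-- A permutation with `m + 1` cycles, of sizes `c₀, …, cₘ`, can be completed to a full cycle by
`m` transpositions in `n ^ (m - 1) * m! * ∏ cᵢ` ways. -/
theorem card_mul_transitiveCompletions {m : ℕ} {f : Perm α} (h : #f.orbits = m + 1) :
    (Fintype.card α * transitiveCompletions m f : ℚ) =
      Fintype.card α ^ m * m.factorial * ∏ s ∈ f.orbits, (#s : ℚ) := by
  induction m generalizing f with
  | zero =>
    rw [transitiveCompletions_zero, if_pos h, ← sum_card_orbits f]
    obtain ⟨s, hs⟩ := card_eq_one.1 h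
    simp [hs]
  | succ m ih =>
    have hpair : ∀ p ∈ (univ : Finset α).offDiag,
        (Fintype.card α * transitiveCompletions m (f * swap p.1 p.2) : ℚ) =
          if ¬ f.SameCycle p.1 p.2 then
            (Fintype.card α ^ m * m.factorial * ∏ s ∈ f.orbits, (#s : ℚ)) *
              ((#(f.orbitFinset p.1) : ℚ)⁻¹ + (#(f.orbitFinset p.2) : ℚ)⁻¹) else 0 := by
      intro p _
      split_ifs with hp
      · have hcard : #f.orbits ≤ #(f * swap p.1 p.2).orbits :=
          card_orbits_le_of_sameCycle fun _ _ => hp.of_mul_swap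
        rw [transitiveCompletions_eq_zero (by lia), Nat.cast_zero, mul_zero]
      · have hcard := card_orbits_mul_swap hp
        rw [ih (by lia), prod_card_orbits_mul_swap hp]
        ring
    have hfilter : {p ∈ (univ : Finset α).offDiag | ¬ f.SameCycle p.1 p.2} =
        ({p | ¬ f.SameCycle p.1 p.2} : Finset (α × α)) := by
      ext p
      simp only [mem_filter, mem_offDiag, mem_univ, true_and, and_iff_right_iff_imp]
      exact fun hp hne => hp (hne.sameCycle f)
    have hsum := sum_offDiag_swap fun τ =>
      (Fintype.card α * transitiveCompletions m (f * τ) : ℚ)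
    rw [sum_congr rfl hpair, ← sum_filter, hfilter, ← mul_sum,
      sum_inv_add_inv_card_orbitFinset, h, ← mul_sum] at hsum
    rw [transitiveCompletions_succ, Nat.factorial_succ]
    push_cast at hsum ⊢
    linear_combination -(1 / 2 : ℚ) * hsum

theorem transitiveCompletions_one [Nontrivial α] :
    transitiveCompletions (Fintype.card α - 1) (1 : Perm α) =
      Fintype.card α ^ (Fintype.card α - 2) * (Fintype.card α - 1).factorial := by
  have hcard : 2 ≤ Fintype.card α := Fintype.one_lt_card
  have key := card_mul_transitiveCompletions (m := Fintype.card α - 1) (f := (1 : Perm α))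
    (by rw [card_orbits_one]; lia)
  rw [prod_card_orbits_one, mul_one] at key
  have hpow : Fintype.card α ^ (Fintype.card α - 1) =
      Fintype.card α * Fintype.card α ^ (Fintype.card α - 2) := by
    rw [← pow_succ']
    congr 1
    lia
  refine Nat.eq_of_mul_eq_mul_left (by lia : 0 < Fintype.card α) ?_
  rw [← mul_assoc, ← hpow]
  exact_mod_cast key

/-- The factorizations of `σ` as an ordered product of `m` transpositions. -/
def swapFactorizations (m : ℕ) (σ : Perm α) : Finset (Fin m → Perm α) :=
  {τ ∈ Fintype.piFinset fun _ => swaps α | (List.ofFn τ).prod = σ}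

theorem mem_swapFactorizations {m : ℕ} {σ : Perm α} {τ : Fin m → Perm α} :
    τ ∈ swapFactorizations m σ ↔ (∀ i, (τ i).IsSwap) ∧ (List.ofFn τ).prod = σ := by
  simp [swapFactorizations, mem_swaps]

theorem card_swapFactorizations_le_conj (m : ℕ) (σ g : Perm α) :
    #(swapFactorizations m σ) ≤ #(swapFactorizations m (g * σ * g⁻¹)) := by
  refine card_le_card_of_injOn (fun τ i => MulAut.conj g (τ i)) ?_ ?_
  · intro τ hτ
    obtain ⟨hswap, rfl⟩ := mem_swapFactorizations.1 hτ
    refine mem_swapFactorizations.2 ⟨fun i => ?_, ?_⟩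
    · simp only [MulAut.conj_apply]
      rw [← card_support_eq_two, card_support_conj, card_support_eq_two]
      exact hswap i
    · rw [← MulAut.conj_apply, map_list_prod, List.map_ofFn]
      rfl
  · intro τ _ τ' _ h
    funext i
    exact (MulAut.conj g).injective (congrFun h i)

theorem card_swapFactorizations_eq_of_isConj (m : ℕ) {σ σ' : Perm α} (h : IsConj σ σ') :
    #(swapFactorizations m σ) = #(swapFactorizations m σ') := by
  have hle : ∀ {σ σ' : Perm α}, IsConj σ σ' →
      #(swapFactorizations m σ) ≤ #(swapFactorizations m σ') := by
    intro σ σ' h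
    obtain ⟨g, rfl⟩ := isConj_iff.1 h
    exact card_swapFactorizations_le_conj m σ g
  exact (hle h).antisymm (hle h.symm)

theorem transitiveCompletions_one_eq_sum [Nontrivial α] (m : ℕ) :
    transitiveCompletions m (1 : Perm α) =
      ∑ σ : Perm α with σ.cycleType = {Fintype.card α}, #(swapFactorizations m σ) := by
  rw [transitiveCompletions, card_eq_sum_card_fiberwise (f := fun τ => (List.ofFn τ).prod)
    (t := ({σ | σ.cycleType = {Fintype.card α}} : Finset (Perm α)))]
  · refine sum_congr rfl fun σ hσ => congrArg card ?_
    rw [swapFactorizations, filter_filter]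
    refine filter_congr fun τ _ => and_iff_right_of_imp ?_
    rintro rfl
    rw [one_mul, card_orbits_eq_one_iff_cycleType]
    exact (mem_filter.1 hσ).2
  · intro τ hτ
    have h := (mem_filter.1 hτ).2
    rw [one_mul, card_orbits_eq_one_iff_cycleType] at h
    simpa using h

theorem card_swapFactorizations_of_cycleType [Nontrivial α] {σ : Perm α}
    (hσ : σ.cycleType = {Fintype.card α}) :
    #(swapFactorizations (Fintype.card α - 1) σ) =
      Fintype.card α ^ (Fintype.card α - 2) := by
  have hsum := transitiveCompletions_one_eq_sum (α := α) (Fintype.card α - 1)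
  rw [transitiveCompletions_one, sum_congr rfl fun σ' hσ' =>
    card_swapFactorizations_eq_of_isConj _
      (isConj_iff_cycleType_eq.2 ((mem_filter.1 hσ').2.trans hσ.symm)),
    sum_const, smul_eq_mul, card_of_cycleType_singleton Fintype.one_lt_card le_rfl,
    Nat.choose_self, mul_one, mul_comm] at hsum
  exact (Nat.eq_of_mul_eq_mul_left (Nat.factorial_pos _) hsum).symm

end Factorizations

end Equiv.Perm

/-- Dénes' theorem: the number of ways to write an `n`-cycle in `Equiv.Perm (Fin n)`
as an ordered product of `n - 1` transpositions is `n ^ (n - 2)`. -/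
theorem denes_factorization_count (n : ℕ) (hn : 2 ≤ n)
    (σ : Equiv.Perm (Fin n)) (hσ : σ.IsCycle) (hsupp : σ.support = Finset.univ) :
    Nat.card {τ : Fin (n - 1) → Equiv.Perm (Fin n) //
      (∀ i, (τ i).IsSwap) ∧ (List.ofFn τ).prod = σ} = n ^ (n - 2) := by
  have : Nontrivial (Fin n) := Fin.nontrivial_iff_two_le.2 hn
  have hcount := Equiv.Perm.card_swapFactorizations_of_cycleType (σ := σ)
    (by rw [hσ.cycleType, hsupp, Finset.card_univ])
  rw [Fintype.card_fin] at hcount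
  rw [← hcount]
  exact Nat.subtype_card _ fun τ => Equiv.Perm.mem_swapFactorizations
end

section
/- Let d ≥ 1 and let α = (α_1, …, α_m) be a partition of d into m parts with every α_i ≥ 1, and set k = Σ_{i=1}^m (α_i − 1) = d − m. Let ξ be a fixed permutation in Equiv.Perm (Fin d) with cycle structure α. Then the number N of ordered k-tuples (σ_1, …, σ_k) of transpositions in Equiv.Perm (Fin d) with σ_1 * σ_2 * ⋯ * σ_k = ξ satisfies N · Π_{i=1}^m (α_i)! = k! · Π_{i=1}^m α_i^{α_i − 1}. (This is the combinatorial content of Lemma 3.8: the multiplicity m_α equals the number of ways of writing a given permutation of cycle structure α as an ordered product of k transpositions, and m_α = k! Π_i α_i^{α_i−1}/α_i!.) -/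
open Finset in
/-- The alternating binomial sum of a power below the number of differences vanishes. -/
theorem alternating_sum_choose_mul_pow_eq_zero {n r : ℕ} (h : r < n) :
    ∑ j ∈ range (n + 1), (n.choose j : ℚ) * (-1) ^ (n - j) * (j : ℚ) ^ r = 0 := by
  have h1 := fwdDiff_iter_eq_sum_shift (1 : ℚ) (fun x : ℚ => x ^ r) n 0
  rw [fwdDiff_iter_pow_eq_zero_of_lt h] at h1
  rw [Pi.zero_apply] at h1
  rw [h1]
  refine sum_congr rfl fun j _ => ?_
  simp only [zsmul_eq_mul, nsmul_eq_mul, mul_one, zero_add]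
  push_cast
  ring

open Finset in
/-- A form of Abel's binomial identity. -/
theorem abel_sum_choose (n : ℕ) (y : ℚ) :
    ∑ j ∈ Ico 1 (n + 1), (n.choose j : ℚ) * (j : ℚ) ^ (j - 1) * (y - j) ^ (n - j)
      = n * y ^ (n - 1) := by
  have expand : ∀ j ∈ Ico 1 (n + 1),
      (n.choose j : ℚ) * (j : ℚ) ^ (j - 1) * (y - j) ^ (n - j)
        = ∑ i ∈ range n, (if j ≤ n - i then (n.choose i : ℚ) * y ^ i *
            (((n - i).choose j : ℚ) * (-1) ^ (n - i - j) * (j : ℚ) ^ (n - i - 1)) else 0) := by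
    intro j hj
    rw [mem_Ico] at hj
    rw [sub_eq_add_neg, add_pow, mul_sum, ← sum_filter]
    have hset : (range n).filter (fun i => j ≤ n - i) = range (n - j + 1) := by
      ext i; simp only [mem_filter, mem_range]; omega
    rw [hset]
    refine sum_congr rfl fun i hi => ?_
    rw [mem_range] at hi
    have hc : n.choose j * (n - j).choose i = n.choose i * (n - i).choose j := by
      have h1 := Nat.choose_mul (n := n) (k := i + j) (s := j) (by omega)
      have h2 := Nat.choose_mul (n := n) (k := i + j) (s := i) (by omega)
      rw [show i + j - j = i by omega] at h1
      rw [show i + j - i = j by omega] at h2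
      rw [← h1, ← h2, Nat.choose_symm_add]
    have hc' : (n.choose j : ℚ) * ((n - j).choose i : ℚ)
        = (n.choose i : ℚ) * ((n - i).choose j : ℚ) := by exact_mod_cast hc
    rw [show n - i - j = n - j - i by omega,
      show n - i - 1 = (j - 1) + (n - j - i) by omega, pow_add, neg_pow (j : ℚ)]
    linear_combination (j : ℚ) ^ (j - 1) * y ^ i * (-1) ^ (n - j - i) * (j : ℚ) ^ (n - j - i) * hc'
  rw [sum_congr rfl expand, sum_comm]
  rcases n with _ | n
  · simp
  rw [sum_range_succ, sum_eq_zero]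
  · have hsub : n + 1 - n = 1 := by omega
    rw [sum_eq_single 1]
    · simp [hsub]
    · intro b hb hb1
      rw [mem_Ico] at hb
      rw [if_neg (by omega)]
    · simp
  · intro i hi
    rw [mem_range] at hi
    have h0 := alternating_sum_choose_mul_pow_eq_zero
      (n := n + 1 - i) (r := n + 1 - i - 1) (by omega)
    rw [← sum_filter, ← mul_sum]
    have hset : (Ico 1 (n + 1 + 1)).filter (fun j => j ≤ n + 1 - i) = Ico 1 (n + 1 - i + 1) := by
      ext j; simp only [mem_filter, mem_Ico]; omega
    rw [hset]
    rw [range_eq_Ico, sum_eq_sum_Ico_succ_bot (by omega)] at h0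
    have hz : ((0 : ℕ) : ℚ) ^ (n + 1 - i - 1) = 0 := by
      rw [Nat.cast_zero, zero_pow]; omega
    rw [hz, mul_zero, zero_add, zero_add] at h0
    rw [h0, mul_zero]

/-- The contribution of a cycle of length `n` to the number of minimal factorizations. -/
def cycleWeight (n : ℕ) : ℚ := (n : ℚ) ^ (n - 1) / n.factorial

theorem cycleWeight_one : cycleWeight 1 = 1 := by simp [cycleWeight]

theorem cycleWeight_ne_zero {n : ℕ} (hn : 0 < n) : cycleWeight n ≠ 0 := by
  unfold cycleWeight
  positivity

open Finset in
theorem mul_sum_cycleWeight_mul_cycleWeight {n : ℕ} (hn : 0 < n) :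
    n * ∑ j ∈ Ico 1 n, cycleWeight j * cycleWeight (n - j) = 2 * (n - 1) * cycleWeight n := by
  have hA := abel_sum_choose n n
  rw [sum_Ico_succ_top (by omega)] at hA
  simp only [Nat.choose_self, Nat.sub_self, pow_zero, Nat.cast_one, one_mul, mul_one] at hA
  have hR := sum_Ico_reflect
    (fun j => (n.choose j : ℚ) * (j : ℚ) ^ (j - 1) * ((n : ℚ) - j) ^ (n - j)) 1
    (show n ≤ n + 1 by omega)
  rw [show n + 1 - n = 1 by omega, show n + 1 - 1 = n by omega] at hR
  have hfac : (n.factorial : ℚ) ≠ 0 := by positivity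
  have key : n.factorial * (n * ∑ j ∈ Ico 1 n, cycleWeight j * cycleWeight (n - j))
      = ∑ j ∈ Ico 1 n, ((n.choose j : ℚ) * (j : ℚ) ^ (j - 1) * ((n : ℚ) - j) ^ (n - j)) +
        ∑ j ∈ Ico 1 n, ((n.choose (n - j) : ℚ) * ((n - j : ℕ) : ℚ) ^ (n - j - 1) *
          ((n : ℚ) - ((n - j : ℕ) : ℚ)) ^ (n - (n - j))) := by
    rw [← sum_add_distrib, mul_sum, mul_sum]
    refine sum_congr rfl fun j hj => ?_
    rw [mem_Ico] at hj
    obtain ⟨i, rfl⟩ := Nat.exists_eq_add_of_lt hj.2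
    obtain ⟨p, rfl⟩ := Nat.exists_eq_add_of_le hj.1
    rw [Nat.choose_symm hj.2.le, Nat.cast_choose ℚ hj.2.le]
    rw [show 1 + p + i + 1 - (1 + p) = i + 1 by omega,
      show 1 + p + i + 1 - (i + 1) = p + 1 by omega, show 1 + p = p + 1 by omega]
    simp only [cycleWeight, Nat.add_sub_cancel]
    have h1 : ((p + 1).factorial : ℚ) ≠ 0 := by positivity
    have h2 : ((i + 1).factorial : ℚ) ≠ 0 := by positivity
    field_simp
    push_cast
    ring
  rw [hR] at key
  have hS : ∑ j ∈ Ico 1 n, ((n.choose j : ℚ) * (j : ℚ) ^ (j - 1) * ((n : ℚ) - j) ^ (n - j))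
      = (n - 1) * (n : ℚ) ^ (n - 1) := by
    linear_combination hA
  rw [hS] at key
  apply mul_left_cancel₀ hfac
  rw [key, cycleWeight]
  field_simp
  ring

section CycleStructure

open Equiv Equiv.Perm

variable {β : Type*} [DecidableEq β]

theorem List.formPerm_append_cons (b : β) (ys : List β) :
    ∀ xs : List β, (xs ++ b :: ys).formPerm = (xs ++ [b]).formPerm * (b :: ys).formPerm
  | [] => by simp
  | [x] => by simp
  | x :: y :: xs => by
    have h := List.formPerm_append_cons b ys (y :: xs)
    simp only [List.cons_append, List.formPerm_cons_cons] at h ⊢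
    rw [h, mul_assoc]

/-- Multiplying by a transposition splits a cycle into two. -/
theorem List.swap_mul_formPerm_append {a b : β} {xs ys : List β}
    (h : (a :: xs ++ b :: ys).Nodup) :
    Equiv.swap a b * (a :: xs ++ b :: ys).formPerm = (a :: xs).formPerm * (b :: ys).formPerm := by
  have hnd : (b :: a :: xs).Nodup := by
    have : (a :: xs ++ [b]).Nodup :=
      h.sublist ((List.Sublist.refl _).append (by simp))
    exact (List.perm_append_singleton b (a :: xs)).nodup_iff.mp this
  have hrot : (a :: xs ++ [b]).formPerm = Equiv.swap a b * (a :: xs).formPerm := by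
    rw [Equiv.swap_comm, ← List.formPerm_cons_cons, ← List.formPerm_rotate_one _ hnd]
    simp
  rw [List.formPerm_append_cons, hrot, ← mul_assoc, ← mul_assoc, swap_mul_self, one_mul]

theorem mul_fixes_of_disjoint {l₁ l₂ : List β} (hl : l₁.Disjoint l₂) {ρ : Perm β}
    (hρ : ∀ x ∈ l₁, ρ x = x) : ∀ x ∈ l₁, (l₂.formPerm * ρ) x = x := by
  intro x hx
  rw [Perm.mul_apply, hρ x hx, List.formPerm_apply_of_notMem (hl hx)]

variable [Fintype β]

/-- The cycle type of a cycle of length `n`, where cycles of length one are discarded. -/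
def cyclePart (n : ℕ) : Multiset ℕ := if 2 ≤ n then {n} else 0

theorem cycleType_formPerm_mul {l : List β} (hl : l.Nodup) {ρ : Perm β}
    (hρ : ∀ x ∈ l, ρ x = x) :
    (l.formPerm * ρ).cycleType = cyclePart l.length + ρ.cycleType := by
  have hd : Disjoint l.formPerm ρ := by
    intro x
    by_cases hx : x ∈ l
    · exact Or.inr (hρ x hx)
    · exact Or.inl (List.formPerm_apply_of_notMem hx)
  rw [hd.cycleType_mul, cyclePart]
  split_ifs with h
  · rw [(List.isCycle_formPerm hl h).cycleType, List.support_formPerm_of_nodup _ hl,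
      List.toFinset_card_of_nodup hl]
    rintro x rfl
    simp at h
  · rw [(List.formPerm_eq_one_iff _ hl).mpr (by omega), cycleType_one]

theorem cycleType_swap_mul_formPerm_append_mul {a b : β} {xs ys : List β}
    (h : (a :: xs ++ b :: ys).Nodup) {ρ : Perm β} (hρ : ∀ x ∈ a :: xs ++ b :: ys, ρ x = x) :
    (swap a b * ((a :: xs ++ b :: ys).formPerm * ρ)).cycleType =
      cyclePart (a :: xs).length + (cyclePart (b :: ys).length + ρ.cycleType) := by
  rw [← mul_assoc, List.swap_mul_formPerm_append h, mul_assoc]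
  rw [List.nodup_append'] at h
  obtain ⟨h1, h2, h3⟩ := h
  rw [cycleType_formPerm_mul h1, cycleType_formPerm_mul h2]
  · exact fun x hx => hρ x (List.mem_append_right _ hx)
  · exact mul_fixes_of_disjoint h3 fun x hx => hρ x (List.mem_append_left _ hx)

theorem toList_formPerm_mul_complement (ξ : Perm β) (a : β) :
    ∃ ρ : Perm β, ξ = (ξ.toList a).formPerm * ρ ∧ ∀ x ∈ ξ.toList a, ρ x = x := by
  refine ⟨(ξ.toList a).formPerm⁻¹ * ξ, by simp, fun x hx => ?_⟩
  rw [Perm.mul_apply, Perm.inv_eq_iff_eq, formPerm_toList,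
    (mem_toList_iff.mp hx).1.cycleOf_apply]

theorem exists_formPerm_cons_mul (ξ : Perm β) (a : β) :
    ∃ (xs : List β) (ρ : Perm β), (a :: xs).Nodup ∧ ξ = (a :: xs).formPerm * ρ ∧
      (∀ x ∈ a :: xs, ρ x = x) ∧ ∀ x ∈ a :: xs, ξ.SameCycle a x := by
  by_cases ha : a ∈ ξ.support
  · obtain ⟨ρ, h1, h2⟩ := toList_formPerm_mul_complement ξ a
    have h0 : (ξ.toList a)[0]? = some a := by
      rw [List.getElem?_eq_getElem (length_toList_pos_of_mem_support ξ a ha),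
        toList_getElem_zero ξ a ha]
    have hs : ∀ x ∈ ξ.toList a, ξ.SameCycle a x := fun x hx => (mem_toList_iff.mp hx).1
    have hn := nodup_toList ξ a
    revert h1 h2 h0 hs hn
    generalize ξ.toList a = l
    intro h1 h2 h0 hs hn
    cases l with
    | nil => simp at h0
    | cons x xs =>
      obtain rfl : x = a := by simpa using h0
      exact ⟨xs, ρ, hn, h1, h2, hs⟩
  · refine ⟨[], ξ, by simp, by simp, ?_, ?_⟩
    · simpa using ha
    · simp [SameCycle.refl]

theorem cycleType_swap_mul_of_not_sameCycle {ξ : Perm β} {a b : β} (h : ¬ ξ.SameCycle a b) :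
    ∃ p q s, 0 < p ∧ 0 < q ∧ ξ.cycleType = cyclePart p + (cyclePart q + s) ∧
      (swap a b * ξ).cycleType = cyclePart (p + q) + s := by
  obtain ⟨xs, ρ₁, hn₁, hξ, hf₁, hs₁⟩ := exists_formPerm_cons_mul ξ a
  obtain ⟨ys, ρ, hn₂, hρ₁, hf₂, hs₂⟩ := exists_formPerm_cons_mul ρ₁ b
  have hb : b ∉ a :: xs := fun hb => h (hs₁ b hb)
  have hdis : (a :: xs).Disjoint (b :: ys) := by
    intro x hx hy
    exact hb ((hs₂ x hy).eq_of_right (hf₁ x hx) ▸ hx)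
  have hf : ∀ x ∈ a :: xs, ρ x = x := by
    intro x hx
    have h1 := hf₁ x hx
    rw [hρ₁, Perm.mul_apply] at h1
    rw [← (b :: ys).formPerm.injective.eq_iff, h1, List.formPerm_apply_of_notMem (hdis hx)]
  have hn : (a :: xs ++ b :: ys).Nodup := List.nodup_append'.mpr ⟨hn₁, hn₂, hdis⟩
  have hfix : ∀ x ∈ a :: xs ++ b :: ys, ρ x = x := fun x hx =>
    (List.mem_append.mp hx).elim (hf x) (hf₂ x)
  have hmerge : swap a b * ξ = (a :: xs ++ b :: ys).formPerm * ρ := by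
    rw [hξ, hρ₁, ← mul_assoc (List.formPerm _), ← List.swap_mul_formPerm_append hn, mul_assoc,
      ← mul_assoc (swap a b), swap_mul_self, one_mul]
  refine ⟨(a :: xs).length, (b :: ys).length, ρ.cycleType, by simp, by simp, ?_, ?_⟩
  · rw [← cycleType_swap_mul_formPerm_append_mul hn hfix, ← hmerge, ← mul_assoc, swap_mul_self,
      one_mul]
  · rw [hmerge, cycleType_formPerm_mul hn hfix, List.length_append]

theorem cycleType_swap_pow_apply_mul {ξ : Perm β} {a : β} {j : ℕ}
    (hj : 0 < j) (hjn : j < (ξ.cycleOf a).support.card) :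
    ∃ s, ξ.cycleType = cyclePart (ξ.cycleOf a).support.card + s ∧
      (swap a ((ξ ^ j) a) * ξ).cycleType =
        cyclePart j + (cyclePart ((ξ.cycleOf a).support.card - j) + s) := by
  obtain ⟨ρ, hξ, hf⟩ := toList_formPerm_mul_complement ξ a
  have hn := nodup_toList ξ a
  have hlen := length_toList ξ a
  rw [← hlen] at hjn ⊢
  have h0 : (ξ.toList a)[0]? = some a := by
    rw [List.getElem?_eq_getElem (by omega), getElem_toList, pow_zero, Perm.one_apply]
  have hjth : (ξ.toList a)[j]? = some ((ξ ^ j) a) := by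
    rw [List.getElem?_eq_getElem hjn, getElem_toList]
  refine ⟨ρ.cycleType, ?_, ?_⟩
  · rw [← cycleType_formPerm_mul hn hf, ← hξ]
  · generalize (ξ ^ j) a = b at hjth
    generalize ξ.toList a = l at *
    obtain ⟨xs, hxs⟩ : ∃ xs, l.take j = a :: xs := by
      cases l with
      | nil => simp at hjn
      | cons x t =>
        obtain ⟨i, rfl⟩ := Nat.exists_eq_add_of_lt hj
        obtain rfl : x = a := by simpa using h0
        exact ⟨t.take (0 + i), by simp⟩
    have hys : l.drop j = b :: l.drop (j + 1) := by
      rw [List.drop_eq_getElem_cons hjn, (List.getElem_eq_iff hjn).mpr hjth]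
    have hl : l = a :: xs ++ b :: l.drop (j + 1) := by rw [← hxs, ← hys, List.take_append_drop]
    have l1 : (a :: xs).length = j := by rw [← hxs, List.length_take]; omega
    have l2 : (b :: l.drop (j + 1)).length = l.length - j := by rw [← hys, List.length_drop]
    rw [hl] at hn hf
    have key := cycleType_swap_mul_formPerm_append_mul hn hf
    rw [l1, l2, ← hl] at key
    rw [hξ, key]

end CycleStructure

section Factorizations

open Equiv Equiv.Perm

variable {β : Type*} [DecidableEq β]

theorem Equiv.Perm.IsSwap.mul_eq_iff {τ π ξ : Perm β} (h : τ.IsSwap) : τ * π = ξ ↔ π = τ * ξ := by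
  obtain ⟨a, b, -, rfl⟩ := h
  constructor
  · rintro rfl
    rw [← mul_assoc, swap_mul_self, one_mul]
  · rintro rfl
    rw [← mul_assoc, swap_mul_self, one_mul]

variable [Fintype β]

/-- The least number of transpositions whose product is `ξ`. -/
def permRank (ξ : Perm β) : ℕ := (ξ.cycleType.map (· - 1)).sum

/-- The product of the weights of the cycles of `ξ`. -/
def permWeight (ξ : Perm β) : ℚ := (ξ.cycleType.map cycleWeight).prod

theorem sum_map_cyclePart (n : ℕ) : ((cyclePart n).map (· - 1)).sum = n - 1 := by
  unfold cyclePart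
  split_ifs
  · simp
  · simp; omega

theorem prod_map_cyclePart {n : ℕ} (hn : 0 < n) :
    ((cyclePart n).map cycleWeight).prod = cycleWeight n := by
  unfold cyclePart
  split_ifs
  · simp
  · obtain rfl : n = 1 := by omega
    simp [cycleWeight_one]

theorem permRank_swap_mul_of_not_sameCycle {ξ : Perm β} {a b : β} (h : ¬ ξ.SameCycle a b) :
    permRank (swap a b * ξ) = permRank ξ + 1 := by
  obtain ⟨p, q, s, hp, hq, h1, h2⟩ := cycleType_swap_mul_of_not_sameCycle h
  simp only [permRank, h1, h2, Multiset.map_add, Multiset.sum_add, sum_map_cyclePart]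
  omega

theorem permRank_swap_pow_apply_mul {ξ : Perm β} {a : β} {j : ℕ}
    (hj : 0 < j) (hjn : j < (ξ.cycleOf a).support.card) :
    permRank (swap a ((ξ ^ j) a) * ξ) + 1 = permRank ξ := by
  obtain ⟨s, h1, h2⟩ := cycleType_swap_pow_apply_mul hj hjn
  simp only [permRank, h1, h2, Multiset.map_add, Multiset.sum_add, sum_map_cyclePart]
  omega

theorem permWeight_swap_pow_apply_mul {ξ : Perm β} {a : β} {j : ℕ}
    (hj : 0 < j) (hjn : j < (ξ.cycleOf a).support.card) :
    permWeight (swap a ((ξ ^ j) a) * ξ) = permWeight ξ / cycleWeight (ξ.cycleOf a).support.card *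
      (cycleWeight j * cycleWeight ((ξ.cycleOf a).support.card - j)) := by
  obtain ⟨s, h1, h2⟩ := cycleType_swap_pow_apply_mul hj hjn
  have hw := cycleWeight_ne_zero (n := (ξ.cycleOf a).support.card) (by omega)
  have hn : 0 < (ξ.cycleOf a).support.card := by omega
  have hd : 0 < (ξ.cycleOf a).support.card - j := by omega
  simp only [permWeight, h1, h2, Multiset.map_add, Multiset.prod_add, prod_map_cyclePart hj,
    prod_map_cyclePart hn, prod_map_cyclePart hd]
  field_simp

theorem exists_pow_apply_eq_of_sameCycle {ξ : Perm β} {a b : β} (h : ξ.SameCycle a b)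
    (hab : a ≠ b) : ∃ j, 0 < j ∧ j < (ξ.cycleOf a).support.card ∧ (ξ ^ j) a = b := by
  have ha : a ∈ ξ.support := by
    rw [mem_support]
    exact fun hfix => hab (h.eq_of_left hfix)
  obtain ⟨j, hj, rfl⟩ := h.exists_pow_eq_of_mem_support ha
  refine ⟨j, Nat.pos_of_ne_zero ?_, hj, rfl⟩
  rintro rfl
  simp at hab

theorem permRank_le_permRank_swap_mul_add_one (ξ : Perm β) {a b : β} (hab : a ≠ b) :
    permRank ξ ≤ permRank (swap a b * ξ) + 1 := by
  by_cases h : ξ.SameCycle a b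
  · obtain ⟨j, h0, hj, rfl⟩ := exists_pow_apply_eq_of_sameCycle h hab
    exact (permRank_swap_pow_apply_mul h0 hj).ge
  · have := permRank_swap_mul_of_not_sameCycle h
    omega

/-- The number of factorizations of `ξ` into `k` transpositions. -/
noncomputable def swapFactorizationCount (k : ℕ) (ξ : Perm β) : ℕ :=
  Nat.card {σ : Fin k → Perm β // (∀ j, (σ j).IsSwap) ∧ (List.ofFn σ).prod = ξ}

theorem swapFactorizationCount_zero_one : swapFactorizationCount 0 (1 : Perm β) = 1 := by
  simp [swapFactorizationCount]

/-- Splitting off the first transposition of a factorization. -/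
def swapFactorizationEquiv (k : ℕ) (ξ : Perm β) :
    {σ : Fin (k + 1) → Perm β // (∀ j, (σ j).IsSwap) ∧ (List.ofFn σ).prod = ξ} ≃
      Σ τ : {τ : Perm β // τ.IsSwap},
        {σ : Fin k → Perm β // (∀ j, (σ j).IsSwap) ∧ (List.ofFn σ).prod = τ.1 * ξ} where
  toFun σ := ⟨⟨σ.1 0, σ.2.1 0⟩, ⟨Fin.tail σ.1, fun j => σ.2.1 j.succ, by
    have h := σ.2.2
    rw [List.ofFn_succ, List.prod_cons, IsSwap.mul_eq_iff (σ.2.1 0)] at h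
    exact h⟩⟩
  invFun p := ⟨Fin.cons p.1.1 p.2.1, by
    refine ⟨Fin.cases p.1.2 p.2.2.1, ?_⟩
    rw [List.ofFn_succ, List.prod_cons, Fin.cons_zero, IsSwap.mul_eq_iff p.1.2]
    simpa using p.2.2.2⟩
  left_inv σ := by simp
  right_inv _ := rfl

open Classical in
theorem swapFactorizationCount_succ (k : ℕ) (ξ : Perm β) :
    swapFactorizationCount (k + 1) ξ =
      ∑ τ : Perm β with τ.IsSwap, swapFactorizationCount k (τ * ξ) := by
  rw [swapFactorizationCount, Nat.card_congr (swapFactorizationEquiv k ξ), Nat.card_sigma,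
    ← Finset.sum_subtype_eq_sum_filter]
  simp only [Finset.subtype_univ]
  rfl

open Classical in
/-- Every transposition arises from exactly two ordered pairs. -/
theorem sum_swap_eq_two_mul_sum_isSwap (g : Perm β → ℚ) :
    ∑ a, ∑ b with a ≠ b, g (swap a b) = 2 * ∑ τ : Perm β with τ.IsSwap, g τ := by
  have h1 : ∑ a, ∑ b with a ≠ b, g (swap a b)
      = ∑ p : β × β with p.1 ≠ p.2, g (swap p.1 p.2) := by
    simp only [Finset.sum_filter, Fintype.sum_prod_type]
  rw [h1, ← Finset.sum_fiberwise_of_maps_to (t := Finset.univ.filter (fun τ : Perm β => τ.IsSwap))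
    (g := fun p : β × β => swap p.1 p.2), Finset.mul_sum]
  · refine Finset.sum_congr rfl fun τ hτ => ?_
    obtain ⟨a, b, hab, rfl⟩ := (Finset.mem_filter.mp hτ).2
    have hset : ((Finset.univ.filter (fun p : β × β => p.1 ≠ p.2)).filter
        (fun p => swap p.1 p.2 = swap a b)) = {(a, b), (b, a)} := by
      ext ⟨x, y⟩
      simp only [Finset.mem_filter, Finset.mem_univ, true_and, Finset.mem_insert,
        Finset.mem_singleton, Prod.mk.injEq]
      constructor
      · rintro ⟨hxy, h⟩
        have hx := congrArg (fun e : Perm β => e x) h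
        have hy := congrArg (fun e : Perm β => e y) h
        simp only [swap_apply_left, swap_apply_right] at hx hy
        rw [swap_apply_def] at hx hy
        grind
      · rintro (⟨rfl, rfl⟩ | ⟨rfl, rfl⟩)
        · exact ⟨hab, rfl⟩
        · exact ⟨hab.symm, swap_comm _ _⟩
    rw [hset, Finset.sum_pair (by simp [hab]), swap_comm b a]
    ring
  · rintro ⟨x, y⟩ h
    simp only [Finset.mem_filter, Finset.mem_univ, true_and] at h ⊢
    exact ⟨x, y, h, rfl⟩

theorem swapFactorizationCount_eq_zero_of_lt {k : ℕ} :
    ∀ {ξ : Perm β}, k < permRank ξ → swapFactorizationCount k ξ = 0 := by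
  induction k with
  | zero =>
    intro ξ h
    have hξ : (1 : Perm β) ≠ ξ := by
      rintro rfl
      simp [permRank] at h
    simp [swapFactorizationCount, hξ]
  | succ k ih =>
    intro ξ h
    classical
    rw [swapFactorizationCount_succ]
    refine Finset.sum_eq_zero fun τ hτ => ?_
    obtain ⟨a, b, hab, rfl⟩ := (Finset.mem_filter.mp hτ).2
    have := permRank_le_permRank_swap_mul_add_one ξ hab
    exact ih (by omega)

theorem sum_sameCycle_eq_sum_Ico (ξ : Perm β) (a : β) (g : β → ℚ)
    (hg : ∀ b, a ≠ b → ¬ ξ.SameCycle a b → g b = 0) :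
    ∑ b with a ≠ b, g b = ∑ j ∈ Finset.Ico 1 (ξ.cycleOf a).support.card, g ((ξ ^ j) a) := by
  have hinj : ∀ i < (ξ.cycleOf a).support.card, ∀ j < (ξ.cycleOf a).support.card,
      (ξ ^ i) a = (ξ ^ j) a → i = j := by
    intro i hi j hj h
    rw [← length_toList] at hi hj
    refine (List.Nodup.getElem_inj_iff (nodup_toList ξ a) (hi := hi) (hj := hj)).mp ?_
    rw [getElem_toList, getElem_toList, h]
  symm
  refine Finset.sum_of_injOn (fun j => (ξ ^ j) a) ?_ ?_ ?_ fun _ _ => rfl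
  · intro i hi j hj h
    simp only [Finset.coe_Ico, Set.mem_Ico] at hi hj
    exact hinj i hi.2 j hj.2 h
  · intro j hj
    simp only [Finset.coe_Ico, Set.mem_Ico] at hj
    simp only [Finset.coe_filter, Finset.mem_univ, true_and, Set.mem_ofPred_eq]
    intro h
    have := hinj 0 (by omega) j hj.2 (by simpa using h)
    omega
  · intro b hb hb'
    simp only [Finset.mem_filter, Finset.mem_univ, true_and] at hb
    refine hg b hb fun hs => hb' ?_
    obtain ⟨j, h0, hj, rfl⟩ := exists_pow_apply_eq_of_sameCycle hs hb
    exact ⟨j, by simp; omega, rfl⟩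

/-- Summing `(n - 1) / n` over all points, where `n` is the length of the cycle of the point. -/
theorem sum_card_cycleOf_sub_one_div (ξ : Perm β) :
    ∑ a, (((ξ.cycleOf a).support.card : ℚ) - 1) / (ξ.cycleOf a).support.card = permRank ξ := by
  have h1 : ∑ a, (((ξ.cycleOf a).support.card : ℚ) - 1) / (ξ.cycleOf a).support.card
      = ∑ a ∈ ξ.support, (((ξ.cycleOf a).support.card : ℚ) - 1) / (ξ.cycleOf a).support.card := by
    symm
    refine Finset.sum_subset (Finset.subset_univ _) fun a _ ha => ?_
    rw [notMem_support, ← cycleOf_eq_one_iff] at ha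
    simp [ha]
  rw [h1, ← Finset.sum_fiberwise_of_maps_to (t := ξ.cycleFactorsFinset) (g := fun a => ξ.cycleOf a)
    fun a ha => cycleOf_mem_cycleFactorsFinset_iff.mpr ha]
  rw [permRank, cycleType_def, Multiset.map_map, ← Finset.sum_eq_multiset_sum, Nat.cast_sum]
  refine Finset.sum_congr rfl fun c hc => ?_
  have hfib : ξ.support.filter (fun a => ξ.cycleOf a = c) = c.support := by
    ext a
    rw [Finset.mem_filter]
    constructor
    · rintro ⟨ha, rfl⟩
      rwa [mem_support_cycleOf_iff, and_iff_right (SameCycle.refl ξ a)]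
    · intro ha
      exact ⟨mem_cycleFactorsFinset_support_le hc ha, (cycle_is_cycleOf ha hc).symm⟩
  have hcard : 2 ≤ c.support.card := (mem_cycleFactorsFinset_iff.mp hc).1.two_le_card_support
  rw [Finset.sum_congr rfl (g := fun _ => ((c.support.card : ℚ) - 1) / c.support.card)
    fun a ha => by rw [(Finset.mem_filter.mp ha).2], hfib, Finset.sum_const, nsmul_eq_mul]
  have : (c.support.card : ℚ) ≠ 0 := by positivity
  simp only [Function.comp_apply]
  rw [Nat.cast_sub (by omega)]
  field_simp
  simp

theorem sum_permWeight_swap_mul (ξ : Perm β) (a : β) :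
    ∑ j ∈ Finset.Ico 1 (ξ.cycleOf a).support.card, permWeight (swap a ((ξ ^ j) a) * ξ) =
      permWeight ξ *
        (2 * ((((ξ.cycleOf a).support.card : ℚ) - 1) / (ξ.cycleOf a).support.card)) := by
  rcases Nat.eq_zero_or_pos (ξ.cycleOf a).support.card with h0 | hpos
  · simp [h0]
  have hw := cycleWeight_ne_zero hpos
  have key := mul_sum_cycleWeight_mul_cycleWeight hpos
  rw [Finset.sum_congr rfl fun j hj => permWeight_swap_pow_apply_mul
    (Finset.mem_Ico.mp hj).1 (Finset.mem_Ico.mp hj).2, ← Finset.mul_sum]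
  have : ((ξ.cycleOf a).support.card : ℚ) ≠ 0 := by positivity
  field_simp
  linear_combination permWeight ξ * key

/-- The number of minimal factorizations of a permutation into transpositions. -/
theorem swapFactorizationCount_permRank {k : ℕ} :
    ∀ {ξ : Perm β}, permRank ξ = k →
      (swapFactorizationCount k ξ : ℚ) = k.factorial * permWeight ξ := by
  induction k with
  | zero =>
    intro ξ h
    have hξ : ξ = 1 := by
      rw [← cycleType_eq_zero]
      refine Multiset.eq_zero_of_forall_notMem fun n hn => ?_
      have h2 := two_le_of_mem_cycleType hn
      have := Multiset.single_le_sum (fun _ _ => Nat.zero_le _) _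
        (Multiset.mem_map_of_mem (· - 1) hn)
      rw [permRank] at h
      omega
    subst hξ
    simp [swapFactorizationCount_zero_one, permWeight]
  | succ k ih =>
    intro ξ h
    classical
    have hsum := sum_swap_eq_two_mul_sum_isSwap
      (fun τ : Perm β => (swapFactorizationCount k (τ * ξ) : ℚ))
    rw [← Nat.cast_sum, ← swapFactorizationCount_succ] at hsum
    have hrow : ∀ a, ∑ b with a ≠ b, (swapFactorizationCount k (swap a b * ξ) : ℚ) =
        k.factorial * (permWeight ξ *
          (2 * ((((ξ.cycleOf a).support.card : ℚ) - 1) / (ξ.cycleOf a).support.card))) := by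
      intro a
      rw [sum_sameCycle_eq_sum_Ico ξ a, ← sum_permWeight_swap_mul, Finset.mul_sum]
      · refine Finset.sum_congr rfl fun j hj => ih ?_
        have := permRank_swap_pow_apply_mul (Finset.mem_Ico.mp hj).1 (Finset.mem_Ico.mp hj).2
        omega
      · intro b _ hs
        have := permRank_swap_mul_of_not_sameCycle hs
        rw [swapFactorizationCount_eq_zero_of_lt (by omega), Nat.cast_zero]
    rw [Finset.sum_congr rfl fun a _ => hrow a, ← Finset.mul_sum, ← Finset.mul_sum,
      ← Finset.mul_sum, sum_card_cycleOf_sub_one_div, h] at hsum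
    rw [Nat.factorial_succ]
    push_cast at hsum ⊢
    linear_combination -hsum / 2

end Factorizations

/-- Lemma 3.8 (combinatorial content): if `ξ ∈ Equiv.Perm (Fin d)` has cycle structure
`α = (α_1, …, α_m)` (a partition of `d` with all parts positive) and
`k = Σ (α_i - 1)`, then the number `N` of ordered `k`-tuples of transpositions
multiplying to `ξ` satisfies `N · Π (α_i)! = k! · Π α_i ^ (α_i - 1)`. -/
theorem multiplicity_factorization_count (d m : ℕ) (hd : 1 ≤ d)
    (α : Fin m → ℕ) (hα : ∀ i, 1 ≤ α i) (hsum : ∑ i, α i = d)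
    (k : ℕ) (hk : k = ∑ i, (α i - 1))
    (ξ : Equiv.Perm (Fin d))
    (hξ : ξ.cycleType = (Finset.univ.val.map α).filter (fun a => 2 ≤ a)) :
    (Nat.card {σ : Fin k → Equiv.Perm (Fin d) //
        (∀ j, (σ j).IsSwap) ∧ (List.ofFn σ).prod = ξ}) * ∏ i, (α i).factorial
      = k.factorial * ∏ i, (α i) ^ (α i - 1) := by
  have hrank : permRank ξ = k := by
    rw [permRank, hξ, Multiset.filter_map, Multiset.map_map, hk]
    refine Finset.sum_filter_of_ne (s := Finset.univ) (p := fun i => 2 ≤ α i)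
      (f := fun i => α i - 1) fun i _ h => ?_
    omega
  have hweight : permWeight ξ = ∏ i, cycleWeight (α i) := by
    rw [permWeight, hξ, Multiset.filter_map, Multiset.map_map]
    refine Finset.prod_filter_of_ne (s := Finset.univ) (p := fun i => 2 ≤ α i)
      (f := fun i => cycleWeight (α i)) fun i _ h => ?_
    by_contra h2
    have hi := hα i
    exact h (by rw [show α i = 1 by omega, cycleWeight_one])
  have key := swapFactorizationCount_permRank hrank
  rw [hweight] at key
  have hprod : (∏ i, cycleWeight (α i)) * ∏ i, ((α i).factorial : ℚ) =
      ∏ i, (α i : ℚ) ^ (α i - 1) := by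
    rw [← Finset.prod_mul_distrib]
    refine Finset.prod_congr rfl fun i _ => ?_
    rw [cycleWeight, div_mul_cancel₀ _ (by positivity)]
  change swapFactorizationCount k ξ * _ = _
  have : ((swapFactorizationCount k ξ * ∏ i, (α i).factorial : ℕ) : ℚ)
      = ((k.factorial * ∏ i, (α i) ^ (α i - 1) : ℕ) : ℚ) := by
    push_cast
    rw [key, mul_assoc, hprod]
  exact_mod_cast this
end

section
/- Let d ≥ 1, let α = (α_1, …, α_m) be a partition of d into m parts with every α_i ≥ 1, set k = Σ_{i=1}^m (α_i − 1), and let ξ ∈ Equiv.Perm (Fin d) have cycle structure α. Suppose σ_1, …, σ_k are transpositions in Equiv.Perm (Fin d) with σ_1 * ⋯ * σ_k = ξ. Then for every j there is a (necessarily unique) cycle c occurring in the cycle decomposition of ξ such that the support of σ_j is contained in the support of c; moreover, for each cycle c of ξ, of length ℓ, the number of indices j with support of σ_j contained in the support of c is exactly ℓ − 1. (Claim in the proof of Lemma 3.8: if k = Σ(α_i−1) transpositions multiply to ξ = (a_{1,1}…a_{1,α_1})⋯(a_{m,1}…a_{m,α_m}), then for each i exactly α_i−1 of the transpositions are of the form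 (a_{i,j} a_{i,k}).) -/
open Equiv.Perm Module

section DifferenceMap

variable {X J T : Type*}

/-- The linear map sending a function `f` on the vertices of a multigraph to its differences
`f (a j) - f (b j)` along the edges. -/
def edgeDifference (a b : J → X) : (X → ℚ) →ₗ[ℚ] (J → ℚ) :=
  LinearMap.funLeft ℚ ℚ a - LinearMap.funLeft ℚ ℚ b

lemma mem_ker_edgeDifference {a b : J → X} {f : X → ℚ} :
    f ∈ LinearMap.ker (edgeDifference a b) ↔ ∀ j, f (a j) = f (b j) := by
  simp [edgeDifference, funext_iff, sub_eq_zero, LinearMap.funLeft_apply]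

lemma card_le_card_add_finrank_ker_edgeDifference [Fintype X] [Fintype J] (a b : J → X) :
    Fintype.card X ≤ Fintype.card J + finrank ℚ (LinearMap.ker (edgeDifference a b)) := by
  have h := LinearMap.finrank_range_add_finrank_ker (edgeDifference a b)
  have h' := Submodule.finrank_le (LinearMap.range (edgeDifference a b))
  rw [finrank_fintype_fun_eq_card] at h h'
  omega

lemma finrank_le_card_of_determined [Fintype T] (K : Submodule ℚ (X → ℚ)) (rep : T → X)
    (h : ∀ x, ∃ t, ∀ f ∈ K, f x = f (rep t)) : finrank ℚ K ≤ Fintype.card T := by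
  rw [← finrank_fintype_fun_eq_card (R := ℚ)]
  refine LinearMap.finrank_le_finrank_of_injective
    (f := (LinearMap.funLeft ℚ ℚ rep).comp K.subtype) ?_
  intro f g hfg
  ext x
  obtain ⟨t, ht⟩ := h x
  rw [ht f f.2, ht g g.2]
  exact congrFun hfg t

end DifferenceMap

namespace Equiv.Perm

section Invariant

variable {X β : Type*} {f : X → β}

lemma apply_list_prod_eq {l : List (Equiv.Perm X)} (h : ∀ τ ∈ l, ∀ x, f (τ x) = f x) (x : X) :
    f (l.prod x) = f x := by
  induction l with
  | nil => simp
  | cons τ l ih =>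
    rw [List.prod_cons, mul_apply, h τ (by simp), ih fun τ' hτ' => h τ' (by simp [hτ'])]

lemma SameCycle.apply_eq_of_invariant [Finite X] {ξ : Equiv.Perm X} (h : ∀ x, f (ξ x) = f x)
    {x y : X} (hxy : ξ.SameCycle x y) : f x = f y := by
  obtain ⟨i, -, rfl⟩ := hxy.exists_pow_eq'
  rw [← List.prod_replicate]
  exact (apply_list_prod_eq (fun τ hτ => by rw [List.eq_of_mem_replicate hτ]; exact h) x).symm

lemma apply_swap_eq [DecidableEq X] {a b : X} (h : f a = f b) (x : X) :
    f (Equiv.swap a b x) = f x := by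
  rw [Equiv.swap_apply_def]
  split_ifs <;> simp_all

end Invariant

variable {X J : Type*} [Fintype X] [DecidableEq X]

lemma sameCycle_of_mem_support_cycleFactor {ξ c : Equiv.Perm X} (hc : c ∈ ξ.cycleFactorsFinset)
    {x y : X} (hx : x ∈ c.support) (hy : y ∈ c.support) : ξ.SameCycle x y := by
  rw [cycle_is_cycleOf hx hc, mem_support_cycleOf_iff] at hy
  exact hy.1

lemma apply_mem_support_cycleFactor_iff {ξ c : Equiv.Perm X} (hc : c ∈ ξ.cycleFactorsFinset)
    (x : X) : ξ x ∈ c.support ↔ x ∈ c.support := by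
  have := mem_cycleFactorsFinset_iff.mp hc
  constructor
  · intro h
    by_contra hx
    have h1 := cycle_is_cycleOf h hc
    rw [h1, mem_support_cycleOf_iff] at hx
    have h2 : ξ x ∈ ξ.support := mem_cycleFactorsFinset_support_le hc h
    exact hx ⟨(SameCycle.refl ξ x).apply_left, h2⟩
  · intro h
    rw [← this.2 x h]
    exact apply_mem_support.mpr h

/-- If the edges `a j, b j` are at most as many as the defect of `ξ`, and every function constant
along the edges is `ξ`-invariant, then every `ξ`-invariant function is constant along the edges. -/
lemma eq_of_invariant_of_card_le [Fintype J] {ξ : Equiv.Perm X} {a b : J → X}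
    (hcard : Fintype.card J + ξ.cycleFactorsFinset.card ≤ ξ.support.card)
    (hab : ∀ f : X → ℚ, (∀ j, f (a j) = f (b j)) → ∀ x, f (ξ x) = f x)
    {f : X → ℚ} (hf : ∀ x, f (ξ x) = f x) (j : J) : f (a j) = f (b j) := by
  set U := LinearMap.ker (edgeDifference (ξ : X → X) id)
  have hle : LinearMap.ker (edgeDifference a b) ≤ U := fun g hg =>
    mem_ker_edgeDifference.mpr (hab g (mem_ker_edgeDifference.mp hg))
  have hne : ∀ c : ξ.cycleFactorsFinset, ∃ x, x ∈ c.1.support := fun c =>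
    (mem_cycleFactorsFinset_iff.mp c.2).1.nonempty_support
  choose rep hrep using hne
  have hrank : finrank ℚ U ≤ Fintype.card (ξ.cycleFactorsFinset ⊕ (ξ.supportᶜ : Finset X)) := by
    refine finrank_le_card_of_determined U (Sum.elim rep (fun x => x.1)) fun x => ?_
    by_cases hx : x ∈ ξ.support
    · refine ⟨.inl ⟨ξ.cycleOf x, cycleOf_mem_cycleFactorsFinset_iff.mpr hx⟩, fun g hg => ?_⟩
      refine SameCycle.apply_eq_of_invariant (mem_ker_edgeDifference.mp hg) ?_
      exact (mem_support_cycleOf_iff.mp (hrep ⟨ξ.cycleOf x, _⟩)).1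
    · exact ⟨.inr ⟨x, Finset.mem_compl.mpr hx⟩, fun g _ => rfl⟩
  have hker := card_le_card_add_finrank_ker_edgeDifference a b
  have hcompl := Finset.card_add_card_compl ξ.support
  rw [Fintype.card_sum, Fintype.card_coe, Fintype.card_coe] at hrank
  have hEq := Submodule.eq_of_le_of_finrank_le hle (by omega)
  have : f ∈ U := mem_ker_edgeDifference.mpr hf
  rw [← hEq] at this
  exact mem_ker_edgeDifference.mp this j

lemma mem_support_cycleFactor_iff_of_invariant {ξ c : Equiv.Perm X}
    (hc : c ∈ ξ.cycleFactorsFinset) {a b : X}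
    (h : ∀ f : X → ℚ, (∀ x, f (ξ x) = f x) → f a = f b) : a ∈ c.support ↔ b ∈ c.support := by
  have := h (fun x => if x ∈ c.support then 1 else 0)
    (fun x => by simp only [apply_mem_support_cycleFactor_iff hc])
  by_cases h₁ : a ∈ c.support <;> by_cases h₂ : b ∈ c.support <;>
    simp [h₁, h₂, -mem_support] at this ⊢

lemma existsUnique_cycleFactor_support_swap_subset {ξ : Equiv.Perm X} {a b : X} (hne : a ≠ b)
    (h : ∀ f : X → ℚ, (∀ x, f (ξ x) = f x) → f a = f b) :
    ∃! c, c ∈ ξ.cycleFactorsFinset ∧ (Equiv.swap a b).support ⊆ c.support := by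
  have ha : a ∈ ξ.support := by
    by_contra ha
    have ha' : ξ a = a := notMem_support.mp ha
    have := h (fun x => if x = a then 1 else 0)
      (fun x => by
        have hx : ξ x = a ↔ x = a := by rw [← ξ.injective.eq_iff (a := x) (b := a), ha']
        simp only [hx])
    simp [hne.symm] at this
  have hac : a ∈ (ξ.cycleOf a).support :=
    mem_support_cycleOf_iff.mpr ⟨SameCycle.refl _ _, ha⟩
  have hc := cycleOf_mem_cycleFactorsFinset_iff.mpr ha
  rw [support_swap hne]
  refine ⟨ξ.cycleOf a, ⟨hc, ?_⟩, fun c' hc' => ?_⟩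
  · simpa [Finset.insert_subset_iff, -mem_support] using
      ⟨hac, (mem_support_cycleFactor_iff_of_invariant hc h).mp hac⟩
  · exact cycle_is_cycleOf (hc'.2 (by simp)) hc'.1

/-- If every function constant along the edges `a j, b j` is `ξ`-invariant and no edge leaves the
cycle `c`, then at least `c.support.card - 1` edges lie inside `c`. -/
lemma card_support_cycleFactor_le [Fintype J] {ξ c : Equiv.Perm X} {a b : J → X}
    (hc : c ∈ ξ.cycleFactorsFinset)
    (hab : ∀ f : X → ℚ, (∀ j, f (a j) = f (b j)) → ∀ x, f (ξ x) = f x)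
    (hmem : ∀ j, a j ∈ c.support ↔ b j ∈ c.support) :
    c.support.card ≤ (Finset.univ.filter fun j => a j ∈ c.support).card + 1 := by
  let a' : {j // a j ∈ c.support} → c.support := fun j => ⟨a j, j.2⟩
  let b' : {j // a j ∈ c.support} → c.support := fun j => ⟨b j, (hmem j).mp j.2⟩
  obtain ⟨x₀, hx₀⟩ := (mem_cycleFactorsFinset_iff.mp hc).1.nonempty_support
  have hrank : finrank ℚ (LinearMap.ker (edgeDifference a' b')) ≤ Fintype.card Unit := by
    refine finrank_le_card_of_determined _ (fun _ => ⟨x₀, hx₀⟩) fun x => ⟨(), fun f hf => ?_⟩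
    rw [mem_ker_edgeDifference] at hf
    have hinv := hab (fun y => if hy : y ∈ c.support then f ⟨y, hy⟩ else 0) fun j => by
      by_cases hj : a j ∈ c.support
      · simpa only [dif_pos hj, dif_pos ((hmem j).mp hj)] using hf ⟨j, hj⟩
      · simp only [dif_neg hj, dif_neg (mt (hmem j).mpr hj)]
    have := (sameCycle_of_mem_support_cycleFactor hc x.2 hx₀).apply_eq_of_invariant
      (f := fun y => if hy : y ∈ c.support then f ⟨y, hy⟩ else 0) hinv
    simpa only [dif_pos hx₀, dif_pos x.2] using this
  have hker := card_le_card_add_finrank_ker_edgeDifference a' b'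
  rw [Fintype.card_coe, Fintype.card_subtype] at hker
  rw [Fintype.card_unit] at hrank
  omega

end Equiv.Perm

lemma Multiset.sum_filter_two_le_eq_sum_pred_add_card (s : Multiset ℕ) (hs : ∀ a ∈ s, 1 ≤ a) :
    (s.filter fun a => 2 ≤ a).sum = (s.map (· - 1)).sum + (s.filter fun a => 2 ≤ a).card := by
  induction s using Multiset.induction_on with
  | empty => simp
  | cons a s ih =>
    have ih := ih fun b hb => hs b (Multiset.mem_cons_of_mem hb)
    have ha := hs a (Multiset.mem_cons_self a s)
    by_cases h : 2 ≤ a <;>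
      simp [h, ih] <;> omega

/-- Claim in the proof of Lemma 3.8: if `k = Σ (α_i - 1)` transpositions multiply to a
permutation `ξ` of cycle structure `α`, then each transposition has support contained in
the support of a unique cycle of `ξ`, and each cycle of `ξ` of length `ℓ` receives
exactly `ℓ - 1` of the transpositions. -/
theorem transpositions_respect_cycles (d m : ℕ) (hd : 1 ≤ d)
    (α : Fin m → ℕ) (hα : ∀ i, 1 ≤ α i) (hsum : ∑ i, α i = d)
    (k : ℕ) (hk : k = ∑ i, (α i - 1))
    (ξ : Equiv.Perm (Fin d))
    (hξ : ξ.cycleType = (Finset.univ.val.map α).filter (fun a => 2 ≤ a))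
    (σ : Fin k → Equiv.Perm (Fin d))
    (hσ : ∀ j, (σ j).IsSwap) (hprod : (List.ofFn σ).prod = ξ) :
    (∀ j, ∃! c, c ∈ ξ.cycleFactorsFinset ∧ (σ j).support ⊆ c.support) ∧
    (∀ c ∈ ξ.cycleFactorsFinset,
      (Finset.univ.filter (fun j => (σ j).support ⊆ c.support)).card
        = c.support.card - 1) := by
  choose a b hne hswap using hσ
  have hF : ξ.cycleType.card = ξ.cycleFactorsFinset.card := by simp [cycleType_def]
  have hcard : k + ξ.cycleFactorsFinset.card = ξ.support.card := by
    have h := Multiset.sum_filter_two_le_eq_sum_pred_add_card (Finset.univ.val.map α) (by simpa using hα)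
    rw [← hξ, sum_cycleType, hF, Multiset.map_map] at h
    rw [h, hk]
    rfl
  have hab : ∀ f : Fin d → ℚ, (∀ j, f (a j) = f (b j)) → ∀ x, f (ξ x) = f x := by
    intro f hf
    rw [← hprod]
    refine apply_list_prod_eq fun τ hτ => ?_
    obtain ⟨j, rfl⟩ := (List.mem_ofFn' _ _).mp hτ
    rw [hswap j]
    exact apply_swap_eq (hf j)
  have hinv : ∀ j, ∀ f : Fin d → ℚ, (∀ x, f (ξ x) = f x) → f (a j) = f (b j) := fun j f hf =>
    eq_of_invariant_of_card_le (by rw [Fintype.card_fin]; exact hcard.le) hab hf j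
  have hunique : ∀ j, ∃! c, c ∈ ξ.cycleFactorsFinset ∧ (σ j).support ⊆ c.support := fun j => by
    rw [hswap j]
    exact existsUnique_cycleFactor_support_swap_subset (hne j) (hinv j)
  refine ⟨hunique, ?_⟩
  have hmem : ∀ c ∈ ξ.cycleFactorsFinset, ∀ j, a j ∈ c.support ↔ b j ∈ c.support :=
    fun c hc j => mem_support_cycleFactor_iff_of_invariant hc (hinv j)
  have hle : ∀ c ∈ ξ.cycleFactorsFinset, c.support.card ≤
      (Finset.univ.filter fun j => (σ j).support ⊆ c.support).card + 1 := fun c hc => by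
    refine (card_support_cycleFactor_le hc hab (hmem c hc)).trans_eq ?_
    congr 3
    ext j
    rw [hswap j, support_swap (hne j), Finset.insert_subset_iff, Finset.singleton_subset_iff,
      ← hmem c hc j, and_self]
  have hcount : ∑ c ∈ ξ.cycleFactorsFinset,
      (Finset.univ.filter fun j => (σ j).support ⊆ c.support).card = k := by
    have h := Finset.sum_card_bipartiteAbove_eq_sum_card_bipartiteBelow
      (s := ξ.cycleFactorsFinset) (t := (Finset.univ : Finset (Fin k)))
      (fun c j => (σ j).support ⊆ c.support)
    refine h.trans ?_
    rw [Finset.sum_congr rfl (g := fun _ => 1) fun j _ => ?_]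
    · simp
    · obtain ⟨c, hc, hc'⟩ := hunique j
      refine Finset.card_eq_one.mpr ⟨c, Finset.eq_singleton_iff_unique_mem.mpr ⟨?_, ?_⟩⟩
      · exact Finset.mem_filter.mpr hc
      · exact fun c' h' => hc' c' (Finset.mem_filter.mp h')
  have hsupp : ∑ c ∈ ξ.cycleFactorsFinset, c.support.card = ξ.support.card := by
    rw [← sum_cycleType, cycleType_def]
    rfl
  have heq := (Finset.sum_eq_sum_iff_of_le hle).mp (by
    rw [Finset.sum_add_distrib, hcount, hsupp, ← hcard]; simp)
  intro c hc
  have := heq c hc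
  omega
end

section
/- Let d ≥ 2. The number of ordered (d−1)-tuples (τ_1, …, τ_{d−1}) of transpositions in Equiv.Perm (Fin d) such that τ_1, …, τ_{d−1} generate the full symmetric group and the product τ_1 * ⋯ * τ_{d−1} is a d-cycle equals (d−1)! · d^(d−2). Equivalently, the genus-0 one-part Hurwitz number H^0_{(d)}, defined as 1/d! times this count, equals r! · d^(d−2)/d! with r = d − 1. (Formula for H^0_{α_1} stated after Theorem 2.2.) -/
open Finset

namespace Equiv.Perm

variable {V : Type*}

/-- An equivalence relation preserved by one step of `σ` contains the orbit relation of `σ`. -/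
lemma SameCycle.rel_of_step {σ : Perm V} {r : V → V → Prop} (hr : Equivalence r)
    (h : ∀ x, r x (σ x)) {x y : V} (hxy : σ.SameCycle x y) : r x y := by
  obtain ⟨i, rfl⟩ := hxy
  induction i with
  | zero => exact hr.refl x
  | succ n ih =>
    rw [add_comm, zpow_one_add]
    exact hr.trans ih (h _)
  | pred n ih =>
    refine hr.trans ih (hr.symm ?_)
    convert h ((σ ^ (-(n : ℤ) - 1)) x) using 1
    rw [← mul_apply, ← zpow_one_add]
    congr 2
    ring

variable [DecidableEq V]

lemma SameCycle.of_swap_mul {σ : Perm V} {a b x y : V} (hab : σ.SameCycle a b)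
    (h : (swap a b * σ).SameCycle x y) : σ.SameCycle x y := by
  refine h.rel_of_step (SameCycle.equivalence σ) fun z ↦ ?_
  have hz : σ.SameCycle z (σ z) := sameCycle_apply_right.2 SameCycle.rfl
  rw [mul_apply]
  by_cases ha : σ z = a
  · rw [ha, swap_apply_left]
    exact (ha ▸ hz).trans hab
  by_cases hb : σ z = b
  · rw [hb, swap_apply_right]
    exact (hb ▸ hz).trans hab.symm
  · rwa [swap_apply_of_ne_of_ne ha hb]

lemma sameCycle_swap_mul_self [Finite V] {σ : Perm V} {a b : V} (hab : ¬ σ.SameCycle a b) :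
    (swap a b * σ).SameCycle a b := by
  by_contra hn
  have key : ∀ n : ℕ, (swap a b * σ).SameCycle a ((σ ^ n) a) := by
    intro n
    induction n with
    | zero => exact SameCycle.rfl
    | succ n ih =>
      have h1 : (swap a b * σ).SameCycle a ((swap a b * σ) ((σ ^ n) a)) :=
        sameCycle_apply_right.2 ih
      rw [mul_apply, ← mul_apply σ, ← pow_succ'] at h1
      by_cases ha : (σ ^ (n + 1)) a = a
      · rw [ha]
      by_cases hb : (σ ^ (n + 1)) a = b
      · exact absurd ⟨(n + 1 : ℕ), by rw [zpow_natCast, hb]⟩ hab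
      · rwa [swap_apply_of_ne_of_ne ha hb] at h1
  obtain ⟨n, hn'⟩ := (sameCycle_symm_apply_right.2 SameCycle.rfl :
    σ.SameCycle a (σ.symm a)).exists_nat_pow_eq
  have h := sameCycle_apply_right.2 (key n)
  rw [hn', mul_apply, apply_symm_apply, swap_apply_left] at h
  exact hn h

lemma sameCycle_swap_mul_iff [Finite V] {σ : Perm V} {a b x y : V} (hab : ¬ σ.SameCycle a b) :
    (swap a b * σ).SameCycle x y ↔ σ.SameCycle x y ∨
      (σ.SameCycle a x ∨ σ.SameCycle b x) ∧ (σ.SameCycle a y ∨ σ.SameCycle b y) := by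
  have hself := sameCycle_swap_mul_self hab
  have hmono : ∀ {z w}, σ.SameCycle z w → (swap a b * σ).SameCycle z w := fun h ↦
    hself.of_swap_mul (by rwa [swap_mul_self_mul])
  constructor
  · intro h
    refine h.rel_of_step (r := fun x y ↦ σ.SameCycle x y ∨ (σ.SameCycle a x ∨ σ.SameCycle b x) ∧
      (σ.SameCycle a y ∨ σ.SameCycle b y)) ⟨fun _ ↦ .inl .rfl, ?_, ?_⟩ fun z ↦ ?_
    · rintro z w (h | h)
      exacts [.inl h.symm, .inr h.symm]
    · rintro z w v (h | ⟨hz, hw⟩) (h' | ⟨hw', hv⟩)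
      · exact .inl (h.trans h')
      · exact .inr ⟨hw'.imp (·.trans h.symm) (·.trans h.symm), hv⟩
      · exact .inr ⟨hz, hw.imp (·.trans h') (·.trans h')⟩
      · exact .inr ⟨hz, hv⟩
    · have hz : σ.SameCycle (σ z) z := sameCycle_apply_left.2 .rfl
      rw [mul_apply]
      by_cases ha : σ z = a
      · rw [ha, swap_apply_left]
        exact .inr ⟨.inl (ha ▸ hz), .inr .rfl⟩
      by_cases hb : σ z = b
      · rw [hb, swap_apply_right]
        exact .inr ⟨.inr (hb ▸ hz), .inl .rfl⟩
      · rw [swap_apply_of_ne_of_ne ha hb]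
        exact .inl hz.symm
  · rintro (h | ⟨hx, hy⟩)
    · exact hmono h
    · have : ∀ {z}, σ.SameCycle a z ∨ σ.SameCycle b z → (swap a b * σ).SameCycle a z :=
        fun h ↦ h.elim hmono (hself.trans <| hmono ·)
      exact (this hx).symm.trans (this hy)

variable [Fintype V]

instance decidableIsSwap (t : Perm V) : Decidable t.IsSwap := decidable_of_iff _ card_support_eq_two

/-- The orbit of `x` under `σ`, as a finset (a singleton if `x` is fixed). -/
def cycleClass (σ : Perm V) (x : V) : Finset V := univ.filter (σ.SameCycle x)

/-- The orbits of `σ`, fixed points included. -/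
def cycleClasses (σ : Perm V) : Finset (Finset V) := univ.image σ.cycleClass

/-- The product of the sizes of the orbits of `σ`. -/
def cycleWeight (σ : Perm V) : ℕ := ∏ P ∈ σ.cycleClasses, #P

@[simp] lemma mem_cycleClass {σ : Perm V} {x y : V} : y ∈ σ.cycleClass x ↔ σ.SameCycle x y := by
  simp [cycleClass]

lemma cycleClass_eq_iff {σ : Perm V} {x y : V} :
    σ.cycleClass x = σ.cycleClass y ↔ σ.SameCycle x y := by
  refine ⟨fun h ↦ mem_cycleClass.1 (h ▸ mem_cycleClass.2 .rfl), fun h ↦ ?_⟩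
  ext z
  simp only [mem_cycleClass]
  exact ⟨h.symm.trans, h.trans⟩

lemma card_cycleClass_pos (σ : Perm V) (x : V) : 0 < #(σ.cycleClass x) :=
  card_pos.2 ⟨x, mem_cycleClass.2 .rfl⟩

lemma cycleClass_mem_cycleClasses (σ : Perm V) (x : V) : σ.cycleClass x ∈ σ.cycleClasses :=
  mem_image_of_mem _ (mem_univ x)

lemma sum_inv_card_cycleClass (σ : Perm V) :
    ∑ x, (#(σ.cycleClass x) : ℚ)⁻¹ = #σ.cycleClasses := by
  rw [← sum_fiberwise_of_maps_to (t := σ.cycleClasses) (g := σ.cycleClass)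
    fun x _ ↦ cycleClass_mem_cycleClasses σ x, card_eq_sum_ones, Nat.cast_sum]
  refine sum_congr rfl fun P hP ↦ ?_
  obtain ⟨x, -, rfl⟩ := mem_image.1 hP
  have hfib : univ.filter (fun y ↦ σ.cycleClass y = σ.cycleClass x) = σ.cycleClass x := by
    ext y
    simp [cycleClass_eq_iff, sameCycle_comm]
  rw [sum_congr rfl fun y hy ↦ by rw [(mem_filter.1 hy).2], sum_const, hfib, nsmul_eq_mul,
    mul_inv_cancel₀ (by exact_mod_cast (card_cycleClass_pos σ x).ne'), Nat.cast_one]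

lemma card_cycleClasses_le_swap_mul {σ : Perm V} {a b : V} (hab : σ.SameCycle a b) :
    #σ.cycleClasses ≤ #(swap a b * σ).cycleClasses := by
  rw [← Nat.cast_le (α := ℚ), ← sum_inv_card_cycleClass, ← sum_inv_card_cycleClass]
  refine sum_le_sum fun x _ ↦ inv_anti₀ (by exact_mod_cast card_cycleClass_pos _ x) ?_
  refine Nat.cast_le.2 (card_le_card fun y ↦ ?_)
  simpa only [mem_cycleClass] using hab.of_swap_mul

lemma cycleClasses_swap_mul {σ : Perm V} {a b : V} (hab : ¬ σ.SameCycle a b) :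
    (swap a b * σ).cycleClasses = insert (σ.cycleClass a ∪ σ.cycleClass b)
      ((σ.cycleClasses.erase (σ.cycleClass a)).erase (σ.cycleClass b)) := by
  have hin : ∀ x, σ.SameCycle a x ∨ σ.SameCycle b x →
      (swap a b * σ).cycleClass x = σ.cycleClass a ∪ σ.cycleClass b := by
    intro x hx
    ext y
    simp only [mem_cycleClass, mem_union, sameCycle_swap_mul_iff hab, hx, true_and,
      or_iff_right_iff_imp]
    exact fun h ↦ hx.imp (·.trans h) (·.trans h)
  have hout : ∀ x, ¬ (σ.SameCycle a x ∨ σ.SameCycle b x) →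
      (swap a b * σ).cycleClass x = σ.cycleClass x := by
    intro x hx
    ext y
    simp only [mem_cycleClass, sameCycle_swap_mul_iff hab, hx, false_and, or_false]
  ext P
  simp only [mem_insert, mem_erase]
  constructor
  · intro hP
    obtain ⟨x, -, rfl⟩ := mem_image.1 hP
    by_cases hx : σ.SameCycle a x ∨ σ.SameCycle b x
    · exact .inl (hin x hx)
    · rw [hout x hx]
      push Not at hx
      simp only [ne_eq, cycleClass_eq_iff, cycleClass_mem_cycleClasses, and_true]
      exact .inr ⟨fun h ↦ hx.2 h.symm, fun h ↦ hx.1 h.symm⟩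
  · rintro (rfl | ⟨hb, ha, hP⟩)
    · rw [← hin a (.inl .rfl)]
      exact cycleClass_mem_cycleClasses _ a
    · obtain ⟨x, -, rfl⟩ := mem_image.1 hP
      rw [ne_eq, cycleClass_eq_iff, sameCycle_comm] at ha hb
      rw [← hout x (not_or.2 ⟨ha, hb⟩)]
      exact cycleClass_mem_cycleClasses _ x

lemma union_notMem_erase_cycleClasses (σ : Perm V) (a b : V) :
    σ.cycleClass a ∪ σ.cycleClass b ∉
      (σ.cycleClasses.erase (σ.cycleClass a)).erase (σ.cycleClass b) := by
  intro h
  simp only [mem_erase] at h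
  obtain ⟨-, ha, hP⟩ := h
  obtain ⟨x, -, hx⟩ := mem_image.1 hP
  have : a ∈ σ.cycleClass x := hx ▸ mem_union_left _ (mem_cycleClass.2 .rfl)
  exact ha (hx ▸ cycleClass_eq_iff.2 (mem_cycleClass.1 this))

lemma cycleClass_mem_erase {σ : Perm V} {a b : V} (hab : ¬ σ.SameCycle a b) :
    σ.cycleClass b ∈ σ.cycleClasses.erase (σ.cycleClass a) :=
  mem_erase.2 ⟨fun h ↦ hab (cycleClass_eq_iff.1 h.symm), cycleClass_mem_cycleClasses σ b⟩

lemma card_cycleClasses_swap_mul {σ : Perm V} {a b : V} (hab : ¬ σ.SameCycle a b) :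
    #(swap a b * σ).cycleClasses + 1 = #σ.cycleClasses := by
  rw [cycleClasses_swap_mul hab, card_insert_of_notMem (union_notMem_erase_cycleClasses σ a b),
    card_erase_add_one (cycleClass_mem_erase hab),
    card_erase_add_one (cycleClass_mem_cycleClasses σ a)]

lemma cycleWeight_swap_mul {σ : Perm V} {a b : V} (hab : ¬ σ.SameCycle a b) :
    ((swap a b * σ).cycleWeight : ℚ) =
      σ.cycleWeight * ((#(σ.cycleClass a) : ℚ)⁻¹ + (#(σ.cycleClass b) : ℚ)⁻¹) := by
  have hdisj : _root_.Disjoint (σ.cycleClass a) (σ.cycleClass b) := by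
    refine disjoint_left.2 fun x hx hx' ↦ hab ?_
    exact (mem_cycleClass.1 hx).trans (mem_cycleClass.1 hx').symm
  have ha : (#(σ.cycleClass a) : ℚ) ≠ 0 := by exact_mod_cast (card_cycleClass_pos σ a).ne'
  have hb : (#(σ.cycleClass b) : ℚ) ≠ 0 := by exact_mod_cast (card_cycleClass_pos σ b).ne'
  rw [cycleWeight, cycleClasses_swap_mul hab,
    prod_insert (union_notMem_erase_cycleClasses σ a b), card_union_of_disjoint hdisj, cycleWeight,
    ← mul_prod_erase _ _ (cycleClass_mem_cycleClasses σ a),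
    ← mul_prod_erase _ _ (cycleClass_mem_erase hab)]
  push_cast
  field_simp
  ring

lemma card_cycleClasses_swap_mul_add_one_eq_iff {σ : Perm V} {a b : V} :
    #(swap a b * σ).cycleClasses + 1 = #σ.cycleClasses ↔ ¬ σ.SameCycle a b := by
  refine ⟨fun h hab ↦ ?_, card_cycleClasses_swap_mul⟩
  have := card_cycleClasses_le_swap_mul hab
  lia

lemma IsSwap.card_cycleClasses_le {t : Perm V} (ht : t.IsSwap) (σ : Perm V) :
    #σ.cycleClasses ≤ #(t * σ).cycleClasses + 1 := by
  obtain ⟨a, b, -, rfl⟩ := ht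
  by_cases hab : σ.SameCycle a b
  · exact (card_cycleClasses_le_swap_mul hab).trans (Nat.le_succ _)
  · exact (card_cycleClasses_swap_mul hab).ge

lemma sum_offDiag_swap_s3 {M : Type*} [AddCommMonoid M] (f : Perm V → M) :
    ∑ p ∈ (univ : Finset V).offDiag, f (swap p.1 p.2) = 2 • ∑ t : Perm V with t.IsSwap, f t := by
  rw [← sum_fiberwise_of_maps_to (t := univ.filter fun t : Perm V ↦ t.IsSwap)
    (g := fun p : V × V ↦ swap p.1 p.2) ?_, smul_sum]
  · refine sum_congr rfl fun t ht ↦ ?_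
    obtain ⟨a, b, hab, rfl⟩ := (mem_filter.1 ht).2
    have hfib : (univ : Finset V).offDiag.filter (fun p ↦ swap p.1 p.2 = swap a b) =
        {(a, b), (b, a)} := by
      ext ⟨x, y⟩
      simp only [mem_filter, mem_offDiag, mem_univ, true_and, mem_insert, mem_singleton,
        Prod.mk.injEq]
      constructor
      · rintro ⟨hxy, h⟩
        have hx : swap a b x = y := by rw [← h, swap_apply_left]
        grind
      · rintro (⟨rfl, rfl⟩ | ⟨rfl, rfl⟩)
        exacts [⟨hab, rfl⟩, ⟨hab.symm, swap_comm _ _⟩]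
    rw [sum_congr rfl fun p hp ↦ by rw [(mem_filter.1 hp).2], sum_const, hfib,
      card_pair (by simp [hab])]
  · intro p hp
    exact mem_filter.2 ⟨mem_univ _, p.1, p.2, (mem_offDiag.1 hp).2.2, rfl⟩

/-- The weighted number of ways to merge two orbits of `σ` by a transposition. -/
lemma sum_cycleWeight_merge (σ : Perm V) :
    ∑ t : Perm V with t.IsSwap ∧ #(t * σ).cycleClasses + 1 = #σ.cycleClasses,
      ((t * σ).cycleWeight : ℚ) =
    σ.cycleWeight * (Fintype.card V * (#σ.cycleClasses - 1)) := by
  have hpair : ∑ a, ∑ b, (if σ.SameCycle a b then 0 else (#(σ.cycleClass a) : ℚ)⁻¹) =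
      Fintype.card V * (#σ.cycleClasses - 1) := by
    have hrow (a : V) : ∑ b, (if σ.SameCycle a b then 0 else (#(σ.cycleClass a) : ℚ)⁻¹) =
        Fintype.card V * (#(σ.cycleClass a) : ℚ)⁻¹ - 1 := by
      have ha : (#(σ.cycleClass a) : ℚ) ≠ 0 := by exact_mod_cast (card_cycleClass_pos σ a).ne'
      have h (b : V) : (if σ.SameCycle a b then 0 else (#(σ.cycleClass a) : ℚ)⁻¹) =
          (#(σ.cycleClass a) : ℚ)⁻¹ - if σ.SameCycle a b then (#(σ.cycleClass a) : ℚ)⁻¹ else 0 := by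
        split_ifs <;> simp
      rw [sum_congr rfl fun b _ ↦ h b, sum_sub_distrib, ← sum_filter, sum_const, sum_const,
        nsmul_eq_mul, nsmul_eq_mul, card_univ]
      change _ - (#(σ.cycleClass a) : ℚ) * _ = _
      rw [mul_inv_cancel₀ ha]
    rw [sum_congr rfl fun a _ ↦ hrow a, sum_sub_distrib, ← mul_sum, sum_inv_card_cycleClass]
    simp
    ring
  have hswap := sum_offDiag_swap_s3 fun t : Perm V ↦
    if #(t * σ).cycleClasses + 1 = #σ.cycleClasses then ((t * σ).cycleWeight : ℚ) else 0
  have hterm (a b : V) :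
      (if #(swap a b * σ).cycleClasses + 1 = #σ.cycleClasses then
        ((swap a b * σ).cycleWeight : ℚ) else 0) =
      σ.cycleWeight * ((if σ.SameCycle a b then 0 else (#(σ.cycleClass a) : ℚ)⁻¹) +
        (if σ.SameCycle b a then 0 else (#(σ.cycleClass b) : ℚ)⁻¹)) := by
    have hcomm : σ.SameCycle b a ↔ σ.SameCycle a b := sameCycle_comm
    by_cases hab : σ.SameCycle a b
    · simp [card_cycleClasses_swap_mul_add_one_eq_iff, hcomm, hab]
    · simp [card_cycleClasses_swap_mul_add_one_eq_iff, hcomm, hab, cycleWeight_swap_mul hab]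
  have hoff : ∑ p ∈ (univ : Finset V).offDiag,
      (if #(swap p.1 p.2 * σ).cycleClasses + 1 = #σ.cycleClasses then
        ((swap p.1 p.2 * σ).cycleWeight : ℚ) else 0) =
      ∑ a, ∑ b, (if #(swap a b * σ).cycleClasses + 1 = #σ.cycleClasses then
        ((swap a b * σ).cycleWeight : ℚ) else 0) := by
    rw [← sum_product', univ_product_univ]
    refine sum_subset (subset_univ _) fun p _ hp ↦ ?_
    have : p.1 = p.2 := by simpa using hp
    rw [this, if_neg (by simp [card_cycleClasses_swap_mul_add_one_eq_iff, SameCycle.rfl,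
      -swap_self])]
  rw [hoff] at hswap
  simp only [hterm, ← mul_sum, sum_add_distrib] at hswap
  rw [sum_comm (f := fun a b ↦ if σ.SameCycle b a then 0 else (#(σ.cycleClass b) : ℚ)⁻¹), hpair,
    nsmul_eq_mul] at hswap
  rw [← filter_filter, sum_filter]
  push_cast at hswap
  linarith

variable (V) in
/-- The sequences of `m` transpositions each of which merges two orbits of the product of the
later ones. -/
def mergingSeqs (m : ℕ) : Finset (Fin m → Perm V) :=
  univ.filter fun τ ↦ (∀ i, (τ i).IsSwap) ∧
    #(List.ofFn τ).prod.cycleClasses + m = Fintype.card V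

lemma cycleClass_one (x : V) : (1 : Perm V).cycleClass x = {x} := by
  ext y
  simp [eq_comm]

lemma card_cycleClasses_one : #(1 : Perm V).cycleClasses = Fintype.card V := by
  rw [cycleClasses, card_image_of_injective _ fun x y h ↦ by simpa [cycleClass_one] using h,
    card_univ]

lemma cycleWeight_one : (1 : Perm V).cycleWeight = 1 := by
  refine prod_eq_one fun P hP ↦ ?_
  obtain ⟨x, -, rfl⟩ := mem_image.1 hP
  rw [cycleClass_one, card_singleton]

lemma card_le_card_cycleClasses_prod_add {m : ℕ} {τ : Fin m → Perm V} (hτ : ∀ i, (τ i).IsSwap) :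
    Fintype.card V ≤ #(List.ofFn τ).prod.cycleClasses + m := by
  induction m with
  | zero => simp [card_cycleClasses_one]
  | succ m ih =>
    have h1 := ih (τ := fun i ↦ τ i.succ) fun i ↦ hτ i.succ
    have h2 := (hτ 0).card_cycleClasses_le (List.ofFn fun i ↦ τ i.succ).prod
    rw [List.ofFn_succ, List.prod_cons]
    lia

lemma cons_mem_mergingSeqs_iff {m : ℕ} {t : Perm V} {τ : Fin m → Perm V} :
    Fin.cons t τ ∈ mergingSeqs V (m + 1) ↔ τ ∈ mergingSeqs V m ∧ t.IsSwap ∧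
      #(t * (List.ofFn τ).prod).cycleClasses + 1 = #(List.ofFn τ).prod.cycleClasses := by
  simp only [mergingSeqs, mem_filter, mem_univ, true_and, Fin.forall_fin_succ, Fin.cons_zero,
    Fin.cons_succ, List.ofFn_succ, List.prod_cons]
  constructor
  · rintro ⟨⟨ht, hτ⟩, h⟩
    have h1 := card_le_card_cycleClasses_prod_add hτ
    have h2 := ht.card_cycleClasses_le (List.ofFn τ).prod
    exact ⟨⟨hτ, by lia⟩, ht, by lia⟩
  · rintro ⟨⟨hτ, h⟩, ht, h'⟩
    exact ⟨⟨ht, hτ⟩, by lia⟩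

lemma sum_cycleWeight_mergingSeqs (m : ℕ) :
    ∑ τ ∈ mergingSeqs V m, ((List.ofFn τ).prod.cycleWeight : ℚ) =
      ∏ i ∈ range m, (Fintype.card V * (Fintype.card V - (i + 1)) : ℚ) := by
  induction m with
  | zero =>
    rw [show mergingSeqs V 0 = univ by ext; simp [mergingSeqs, card_cycleClasses_one]]
    simp [cycleWeight_one]
  | succ m ih =>
    rw [prod_range_succ, ← ih, sum_mul]
    calc ∑ τ ∈ mergingSeqs V (m + 1), ((List.ofFn τ).prod.cycleWeight : ℚ)
        = ∑ τ ∈ mergingSeqs V m, ∑ t : Perm V with t.IsSwap ∧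
            #(t * (List.ofFn τ).prod).cycleClasses + 1 = #(List.ofFn τ).prod.cycleClasses,
            ((t * (List.ofFn τ).prod).cycleWeight : ℚ) := by
          rw [sum_sigma']
          refine (sum_bij' (fun p _ ↦ (Fin.cons p.2 p.1 : Fin (m + 1) → Perm V))
            (fun τ _ ↦ ⟨Fin.tail τ, τ 0⟩) ?_ ?_ ?_ ?_ ?_).symm
          · rintro ⟨τ, t⟩ h
            simpa [cons_mem_mergingSeqs_iff] using h
          · intro τ h
            rw [← Fin.cons_self_tail τ, cons_mem_mergingSeqs_iff] at h
            simpa using h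
          · rintro ⟨τ, t⟩ _
            simp
          · intro τ _
            simp
          · rintro ⟨τ, t⟩ _
            simp [List.ofFn_succ]
      _ = _ := by
          refine sum_congr rfl fun τ hτ ↦ ?_
          have h : (#(List.ofFn τ).prod.cycleClasses + m : ℚ) = Fintype.card V := by
            exact_mod_cast (mem_filter.1 hτ).2.2
          rw [sum_cycleWeight_merge, ← h]
          ring

lemma card_cycleClasses_eq_one_iff [Nontrivial V] {σ : Perm V} :
    #σ.cycleClasses = 1 ↔ σ.IsCycle ∧ σ.support = univ := by
  have hall : #σ.cycleClasses = 1 ↔ ∀ x y, σ.SameCycle x y := by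
    rw [card_eq_one]
    constructor
    · rintro ⟨P, hP⟩ x y
      have h (z : V) : σ.cycleClass z = P := by
        simpa [hP] using cycleClass_mem_cycleClasses σ z
      rw [← cycleClass_eq_iff, h, h]
    · intro h
      obtain ⟨x⟩ : Nonempty V := inferInstance
      refine ⟨σ.cycleClass x, eq_singleton_iff_unique_mem.2
        ⟨cycleClass_mem_cycleClasses σ x, fun P hP ↦ ?_⟩⟩
      obtain ⟨y, -, rfl⟩ := mem_image.1 hP
      exact cycleClass_eq_iff.2 (h y x)
  rw [hall]
  constructor
  · intro h
    have hne (x : V) : σ x ≠ x := by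
      intro hx
      obtain ⟨y, hy⟩ := exists_ne x
      exact hy ((h x y).eq_of_left hx).symm
    obtain ⟨x⟩ : Nonempty V := inferInstance
    exact ⟨⟨x, hne x, fun y _ ↦ h x y⟩, by ext; simp [hne]⟩
  · rintro ⟨hc, hs⟩ x y
    have hne (z : V) : σ z ≠ z := mem_support.1 (hs ▸ mem_univ z)
    exact hc.sameCycle (hne x) (hne y)

lemma cycleWeight_of_card_cycleClasses_eq_one [Nontrivial V] {σ : Perm V}
    (h : #σ.cycleClasses = 1) : σ.cycleWeight = Fintype.card V := by
  obtain ⟨x⟩ : Nonempty V := inferInstance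
  have hmem := cycleClass_mem_cycleClasses σ x
  obtain ⟨hc, hs⟩ := card_cycleClasses_eq_one_iff.1 h
  have hne (z : V) : σ z ≠ z := mem_support.1 (hs ▸ mem_univ z)
  obtain ⟨P, hP⟩ := card_eq_one.1 h
  rw [cycleWeight, hP, prod_singleton]
  rw [hP, mem_singleton] at hmem
  rw [← hmem, ← card_univ]
  congr 1
  ext y
  simpa using hc.sameCycle (hne x) (hne y)

/-- Transpositions whose product is a full cycle generate the symmetric group. -/
lemma closure_eq_top_of_isCycle_prod {m : ℕ} {τ : Fin m → Perm V} (hτ : ∀ i, (τ i).IsSwap)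
    (hc : (List.ofFn τ).prod.IsCycle) (hs : (List.ofFn τ).prod.support = univ) :
    Subgroup.closure (Set.range τ) = ⊤ := by
  have hmem : (List.ofFn τ).prod ∈ Subgroup.closure (Set.range τ) := by
    refine Subgroup.list_prod_mem _ fun t ht ↦ Subgroup.subset_closure ?_
    simpa [List.mem_ofFn] using ht
  have hne (z : V) : (List.ofFn τ).prod z ≠ z := mem_support.1 (hs ▸ mem_univ z)
  have : MulAction.IsPretransitive (Subgroup.closure (Set.range τ)) V := by
    refine ⟨fun x y ↦ ?_⟩
    obtain ⟨i, hi⟩ := hc.sameCycle (hne x) (hne y)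
    exact ⟨⟨_, zpow_mem hmem i⟩, hi⟩
  exact closure_of_isSwap_of_isPretransitive (by rintro _ ⟨i, rfl⟩; exact hτ i)

end Equiv.Perm

open Equiv.Perm

/-- Genus-0 one-part Hurwitz number: the number of ordered `(d-1)`-tuples of
transpositions in `Equiv.Perm (Fin d)` generating the full symmetric group whose
product is a `d`-cycle equals `(d-1)! · d^(d-2)`. -/
theorem hurwitz_genus_zero_one_part (d : ℕ) (hd : 2 ≤ d) :
    Nat.card {τ : Fin (d - 1) → Equiv.Perm (Fin d) //
      (∀ i, (τ i).IsSwap) ∧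
      Subgroup.closure (Set.range τ) = ⊤ ∧
      ((List.ofFn τ).prod).IsCycle ∧
      ((List.ofFn τ).prod).support = Finset.univ}
      = (d - 1).factorial * d ^ (d - 2) := by
  obtain ⟨n, rfl⟩ := Nat.exists_eq_add_of_le' hd
  have hcard : Nat.card {τ : Fin (n + 2 - 1) → Equiv.Perm (Fin (n + 2)) //
      (∀ i, (τ i).IsSwap) ∧ Subgroup.closure (Set.range τ) = ⊤ ∧
      ((List.ofFn τ).prod).IsCycle ∧ ((List.ofFn τ).prod).support = Finset.univ} =
      #(mergingSeqs (Fin (n + 2)) (n + 1)) := by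
    refine Nat.subtype_card _ fun τ ↦ ?_
    have h : #(List.ofFn τ).prod.cycleClasses + (n + 1) = n + 2 ↔
        #(List.ofFn τ).prod.cycleClasses = 1 := by lia
    rw [mergingSeqs, mem_filter, Fintype.card_fin, h, card_cycleClasses_eq_one_iff]
    simp only [mem_univ, true_and]
    exact ⟨fun ⟨hτ, hc, hs⟩ ↦ ⟨hτ, closure_eq_top_of_isCycle_prod hτ hc hs, hc, hs⟩,
      fun ⟨hτ, _, h⟩ ↦ ⟨hτ, h⟩⟩
  have hsum := sum_cycleWeight_mergingSeqs (V := Fin (n + 2)) (n + 1)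
  rw [sum_congr rfl fun τ hτ ↦ by
      rw [cycleWeight_of_card_cycleClasses_eq_one
        (by have := (mem_filter.1 hτ).2.2; rw [Fintype.card_fin] at this; lia)],
    sum_const, nsmul_eq_mul, Fintype.card_fin, prod_mul_distrib, prod_const, card_range] at hsum
  have hfact : ∏ i ∈ range (n + 1), (((n + 2 : ℕ) : ℚ) - (i + 1)) = (n + 1).factorial := by
    rw [← prod_range_reflect, ← prod_range_add_one_eq_factorial, Nat.cast_prod]
    refine prod_congr rfl fun i hi ↦ ?_
    have := mem_range.1 hi
    rw [show n + 1 - 1 - i = n - i by lia, Nat.cast_sub (by lia)]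
    push_cast
    ring
  rw [hcard]
  rw [hfact] at hsum
  have hpos : 0 < n + 2 := by lia
  refine Nat.eq_of_mul_eq_mul_right hpos ?_
  have : #(mergingSeqs (Fin (n + 2)) (n + 1)) * (n + 2) =
    (n + 2) ^ (n + 1) * (n + 1).factorial := by exact_mod_cast hsum
  rw [this]
  simp only [Nat.add_sub_cancel, show n + 2 - 1 = n + 1 by lia]
  ring
end
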